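/- arXiv:2407.12048 — 4 statements merged into one kernel-verified Lean document; each statement's English description precedes it below -/
import Mathlib

section
/- Let p > 1 be real. There exist six points q₁, …, q₆ on the curve |x|ᵖ + |y|ᵖ = 1 such that the area of conv{q₁, …, q₆} is at least (3√3 / (2π)) · V(D_p), where V(D_p) is the area of the Minkowski ball D_p. In particular, the maximal area γ_h(D_p) of a hexagon inscribed in D_p satisfies γ_h(D_p) ≥ (3√3 / (2π)) · V(D_p). -/
open MeasureTheory Set in
lemma hex_line_mem {K : Set (ℝ × ℝ)} (hK : Convex ℝ K) {a b ya yb s : ℝ}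
    (hA : (a, ya) ∈ K) (hB : (b, yb) ∈ K) (h1 : a ≤ s) (h2 : s ≤ b) :
    (s, ya + (yb - ya) / (b - a) * (s - a)) ∈ K := by
  rcases eq_or_lt_of_le (h1.trans h2) with h | h
  · subst h
    have : s = a := le_antisymm h2 h1
    subst this
    simpa using hA
  · have hne : b - a ≠ 0 := by linarith
    have hpos : 0 < b - a := by linarith
    have := hK hA hB (a := (b - s) / (b - a)) (b := (s - a) / (b - a))
      (div_nonneg (by linarith) hpos.le) (div_nonneg (by linarith) hpos.le)
      (by field_simp; ring)
    convert this using 1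
    ext
    · simp; field_simp; ring
    · simp; field_simp; ring

lemma hex_line_integral (a b ya yb : ℝ) :
    ∫ s in a..b, (ya + (yb - ya) / (b - a) * (s - a)) = (b - a) * (ya + yb) / 2 := by
  rw [intervalIntegral.integral_add (by simp)
    (Continuous.intervalIntegrable (by fun_prop) _ _)]
  rw [intervalIntegral.integral_const_mul, intervalIntegral.integral_sub (by simp) (by simp)]
  simp only [intervalIntegral.integral_const, integral_id, smul_eq_mul]
  rcases eq_or_ne b a with h | h
  · subst h; simp
  · have : b - a ≠ 0 := sub_ne_zero.2 h
    field_simp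
    ring

open MeasureTheory Set in
lemma hex_piece {u v : ℝ → ℝ} {a b : ℝ} (hab : a ≤ b) (hv : Continuous v)
    (h : ∀ s, a < s → s ≤ b → u s = v s) :
    IntervalIntegrable u volume a b ∧ ∫ s in a..b, u s = ∫ s in a..b, v s := by
  constructor
  · refine (hv.intervalIntegrable a b).congr ?_
    rw [uIoc_of_le hab]
    intro s hs
    exact (h s hs.1 hs.2).symm
  · refine intervalIntegral.integral_congr_ae (Filter.Eventually.of_forall ?_)
    intro s hs
    rw [uIoc_of_le hab] at hs
    exact h s hs.1 hs.2

open MeasureTheory Set in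
lemma hex_area {K : Set (ℝ × ℝ)} (hK : Convex ℝ K) {a b h0 h1 h2 : ℝ} (hb : 0 ≤ b) (hab : b ≤ a)
    (hsym : ∀ x y : ℝ, (x, y) ∈ K → (-x, -y) ∈ K)
    (m0 : (a, h0) ∈ K) (m1 : (b, h1) ∈ K) (m2 : (b - a, h2) ∈ K) :
    ENNReal.ofReal (h0 * (a - 2 * b) + h1 * (2 * a - b) + h2 * (a + b)) ≤ volume K := by
  let v1 : ℝ → ℝ := fun s => -h0 + (h2 - -h0) / ((b - a) - -a) * (s - -a)
  let v2 : ℝ → ℝ := fun s => h2 + (h1 - h2) / (b - (b - a)) * (s - (b - a))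
  let v3 : ℝ → ℝ := fun s => h1 + (h0 - h1) / (a - b) * (s - b)
  let u : ℝ → ℝ := fun s => if s ≤ b - a then v1 s else if s ≤ b then v2 s else v3 s
  have hu : ∀ s, -a ≤ s → s ≤ a → (s, u s) ∈ K := by
    intro s hs1 hs2
    by_cases c1 : s ≤ b - a
    · have : u s = v1 s := by simp [u, c1]
      rw [this]
      exact hex_line_mem hK (hsym _ _ m0) m2 hs1 c1
    · by_cases c2 : s ≤ b
      · have : u s = v2 s := by simp only [u, c1, c2, if_true, if_false]
        rw [this]
        exact hex_line_mem hK m2 m1 (not_le.1 c1).le c2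
      · have : u s = v3 s := by simp only [u, c1, c2, if_false]
        rw [this]
        exact hex_line_mem hK m1 m0 (not_le.1 c2).le hs2
  have p1 := hex_piece (u := u) (v := v1) (a := -a) (b := b - a) (by linarith)
    (by fun_prop) (by intro s _ h; simp [u, h])
  have p2 := hex_piece (u := u) (v := v2) (a := b - a) (b := b) (by linarith)
    (by fun_prop) (by intro s h h'; simp only [u, h', not_le.2 h, if_true, if_false])
  have p3 := hex_piece (u := u) (v := v3) (a := b) (b := a) (by linarith)
    (by fun_prop) (by
      intro s h h'
      have : ¬ s ≤ b - a := by linarith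
      simp only [u, this, not_le.2 h, if_false])
  have hintg : IntervalIntegrable u volume (-a) a := (p1.1.trans p2.1).trans p3.1
  have hval : ∫ s in (-a)..a, u s = (h0 * (a - 2 * b) + h1 * (2 * a - b) + h2 * (a + b)) / 2 := by
    rw [← intervalIntegral.integral_add_adjacent_intervals (p1.1.trans p2.1) p3.1,
      ← intervalIntegral.integral_add_adjacent_intervals p1.1 p2.1, p1.2, p2.2, p3.2]
    simp only [v1, v2, v3]
    rw [hex_line_integral, hex_line_integral, hex_line_integral]
    ring
  have hum : Measurable u := by
    refine Measurable.ite measurableSet_Iic (by fun_prop) ?_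
    exact Measurable.ite measurableSet_Iic (by fun_prop) (by fun_prop)
  let l : ℝ → ℝ := fun s => - u (-s)
  have hlm : Measurable l := by fun_prop
  have hintg' : IntervalIntegrable (fun s => u (-s)) volume (-a) a := by
    have := (IntervalIntegrable.iff_comp_neg (f := u) (a := -a) (b := a)).1 hintg
    simpa using this.symm
  have hval' : ∫ s in (-a)..a, (u s - l s) =
      h0 * (a - 2 * b) + h1 * (2 * a - b) + h2 * (a + b) := by
    simp only [l, sub_neg_eq_add]
    rw [intervalIntegral.integral_add hintg hintg', intervalIntegral.integral_comp_neg, neg_neg, hval]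
    ring
  have hsub : regionBetween l u (Ioc (-a) a) ⊆ K := by
    rintro ⟨s, y⟩ ⟨hs, hy⟩
    simp only [mem_Ioc, mem_Ioo] at hs hy
    have k1 := hu s hs.1.le hs.2
    have k2 := hsym _ _ (hu (-s) (by linarith) (by linarith))
    rw [neg_neg] at k2
    have hpos : 0 < u s - l s := by linarith
    have := hK k2 k1 (a := (u s - y) / (u s - l s)) (b := (y - l s) / (u s - l s))
      (div_nonneg (by linarith) hpos.le) (div_nonneg (by linarith) hpos.le)
      (by field_simp; ring)
    convert this using 1
    have hne := hpos.ne'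
    ext
    · simp; field_simp; ring
    · simp only [Prod.snd_add, Prod.smul_snd, smul_eq_mul]
      change y = _ * l s + _
      field_simp; ring
  refine le_trans ?_ (measure_mono hsub)
  rw [Measure.volume_eq_prod, volume_regionBetween_eq_lintegral hlm.aemeasurable hum.aemeasurable measurableSet_Ioc, ← hval',
    intervalIntegral.integral_of_le (by linarith)]
  have hI : IntegrableOn (fun s => u s - l s) (Ioc (-a) a) volume := by
    have := hintg.add hintg'
    rw [intervalIntegrable_iff_integrableOn_Ioc_of_le (by linarith)] at this
    refine this.congr_fun ?_ measurableSet_Ioc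
    intro s _
    simp [l]
  calc ENNReal.ofReal (∫ s in Ioc (-a) a, (u s - l s))
      ≤ ENNReal.ofReal (∫ s in Ioc (-a) a, max (u s - l s) 0) := by
        apply ENNReal.ofReal_le_ofReal
        exact integral_mono hI hI.pos_part (fun s => le_max_left _ _)
    _ = ∫⁻ s in Ioc (-a) a, ENNReal.ofReal (max (u s - l s) 0) :=
        ofReal_integral_eq_lintegral_ofReal hI.pos_part
          (Filter.Eventually.of_forall fun s => le_max_right _ _)
    _ = _ := by
        congr 1
        ext s
        simp [ENNReal.ofReal_max]

/-- the upper boundary function of the ball -/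
noncomputable def hexG (p x : ℝ) : ℝ := (1 - |x| ^ p) ^ (1 / p)

lemma hexG_cont {p : ℝ} (hp : 1 < p) : Continuous (hexG p) := by
  unfold hexG
  refine Continuous.rpow_const ?_ (fun x => Or.inr (by positivity))
  refine continuous_const.sub ?_
  exact continuous_abs.rpow_const (fun x => Or.inr (by linarith))

lemma hexG_nonneg {p x : ℝ} (hp : 1 < p) (hx : |x| ≤ 1) : 0 ≤ hexG p x := by
  have : |x| ^ p ≤ 1 := Real.rpow_le_one (abs_nonneg _) hx (by linarith)
  exact Real.rpow_nonneg (by linarith) _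

lemma hexG_neg (p x : ℝ) : hexG p (-x) = hexG p x := by simp [hexG]

lemma hexG_on {p x : ℝ} (hp : 1 < p) (hx : |x| ≤ 1) : |x| ^ p + |hexG p x| ^ p = 1 := by
  rw [abs_of_nonneg (hexG_nonneg hp hx)]
  have : |x| ^ p ≤ 1 := Real.rpow_le_one (abs_nonneg _) hx (by linarith)
  unfold hexG
  rw [← Real.rpow_mul (by linarith), one_div_mul_cancel (by linarith), Real.rpow_one]
  ring

lemma hex_abs_le {p x y : ℝ} (hp : 1 < p) (h : |x| ^ p + |y| ^ p ≤ 1) : |x| ≤ 1 := by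
  by_contra! hc
  have h1 := Real.one_lt_rpow hc (by linarith : 0 < p)
  have := Real.rpow_nonneg (abs_nonneg y) p
  linarith

open MeasureTheory Set in
lemma hex_vol_le {p : ℝ} (hp : 1 < p) :
    (volume {z : ℝ × ℝ | |z.1| ^ p + |z.2| ^ p < 1}).toReal ≤ 2 * ∫ x in (-1 : ℝ)..1, hexG p x := by
  have hc := hexG_cont hp
  have hsub : {z : ℝ × ℝ | |z.1| ^ p + |z.2| ^ p < 1} ⊆
      regionBetween (fun x => - hexG p x) (hexG p) (Icc (-1) 1) := by
    rintro ⟨x, y⟩ h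
    simp only [mem_ofPred_eq] at h
    have hx := hex_abs_le hp h.le
    refine ⟨abs_le.1 hx, ?_⟩
    have : |y| < hexG p x := by
      have hlt : |y| ^ p < 1 - |x| ^ p := by linarith
      have := Real.rpow_lt_rpow (Real.rpow_nonneg (abs_nonneg y) p) hlt
        (by positivity : 0 < 1 / p)
      rwa [← Real.rpow_mul (abs_nonneg y), mul_one_div_cancel (by linarith), Real.rpow_one] at this
    exact abs_lt.1 this
  have hv : volume (regionBetween (fun x => - hexG p x) (hexG p) (Icc (-1) 1)) =
      ENNReal.ofReal (∫ x in Icc (-1 : ℝ) 1, (hexG p - fun x => - hexG p x) x) := by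
    rw [Measure.volume_eq_prod]
    refine volume_regionBetween_eq_integral (hc.neg.integrableOn_Icc) hc.integrableOn_Icc
      measurableSet_Icc ?_
    intro x hx
    have := hexG_nonneg hp (abs_le.2 hx)
    linarith
  have hi : ∫ x in Icc (-1 : ℝ) 1, (hexG p - fun x => - hexG p x) x =
      2 * ∫ x in (-1 : ℝ)..1, hexG p x := by
    rw [intervalIntegral.integral_of_le (by norm_num), integral_Icc_eq_integral_Ioc,
      ← integral_const_mul]
    congr 1
    ext x
    simp; ring
  have hn : 0 ≤ ∫ x in (-1 : ℝ)..1, hexG p x :=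
    intervalIntegral.integral_nonneg (by norm_num) fun x hx => hexG_nonneg hp (abs_le.2 hx)
  refine ENNReal.toReal_le_of_le_ofReal (by positivity) ?_
  rw [← hi, ← hv]
  exact measure_mono hsub

lemma hex_subst {p : ℝ} (hp : 1 < p) :
    ∫ x in (-1 : ℝ)..1, hexG p x = ∫ t in (0 : ℝ)..Real.pi, hexG p (Real.cos t) * Real.sin t := by
  have := intervalIntegral.integral_comp_mul_deriv (a := 0) (b := Real.pi) (f := Real.cos)
    (f' := fun t => - Real.sin t) (g := hexG p) (fun x _ => Real.hasDerivAt_cos x)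
    (by fun_prop) (hexG_cont hp)
  rw [Real.cos_zero, Real.cos_pi, intervalIntegral.integral_symm (-1) 1] at this
  simp only [Function.comp, mul_neg, intervalIntegral.integral_neg] at this
  linarith

lemma hex_exists {p : ℝ} (hp : 1 < p) : ∃ t : ℝ, 0 ≤ t ∧ t ≤ Real.pi / 3 ∧
    3 / Real.pi * (∫ x in (-1 : ℝ)..1, hexG p x) ≤
      hexG p (Real.cos t) * Real.sin t
      + hexG p (Real.cos (t + Real.pi / 3)) * Real.sin (t + Real.pi / 3)
      + hexG p (Real.cos (t + 2 * Real.pi / 3)) * Real.sin (t + 2 * Real.pi / 3) := by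
  have hπ := Real.pi_pos
  have hc := hexG_cont hp
  let f : ℝ → ℝ := fun t => hexG p (Real.cos t) * Real.sin t
  have hf : Continuous f := by fun_prop
  let F : ℝ → ℝ := fun t => f t + f (t + Real.pi / 3) + f (t + 2 * Real.pi / 3)
  have hF : Continuous F := by fun_prop
  have hintg : ∫ t in (0 : ℝ)..(Real.pi / 3), F t = ∫ x in (-1 : ℝ)..1, hexG p x := by
    rw [hex_subst hp]
    have i : ∀ a b, IntervalIntegrable f MeasureTheory.volume a b := fun a b =>
      hf.intervalIntegrable a b
    have e1 : ∫ t in (0 : ℝ)..(Real.pi / 3), F t = (∫ t in (0 : ℝ)..(Real.pi / 3), f t)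
        + (∫ t in (0 : ℝ)..(Real.pi / 3), f (t + Real.pi / 3))
        + ∫ t in (0 : ℝ)..(Real.pi / 3), f (t + 2 * Real.pi / 3) := by
      rw [← intervalIntegral.integral_add, ← intervalIntegral.integral_add] <;>
        exact Continuous.intervalIntegrable (by fun_prop) _ _
    rw [e1, intervalIntegral.integral_comp_add_right, intervalIntegral.integral_comp_add_right,
      zero_add, zero_add, show Real.pi / 3 + Real.pi / 3 = 2 * Real.pi / 3 by ring,
      show Real.pi / 3 + 2 * Real.pi / 3 = Real.pi by ring,
      intervalIntegral.integral_add_adjacent_intervals (i _ _) (i _ _),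
      intervalIntegral.integral_add_adjacent_intervals (i _ _) (i _ _)]
  obtain ⟨t, ht, hmax⟩ := (isCompact_Icc (a := (0 : ℝ)) (b := Real.pi / 3)).exists_isMaxOn
    ⟨0, by constructor <;> positivity⟩ hF.continuousOn
  refine ⟨t, ht.1, ht.2, ?_⟩
  have hle : ∫ t in (0 : ℝ)..(Real.pi / 3), F t ≤ ∫ _ in (0 : ℝ)..(Real.pi / 3), F t :=
    intervalIntegral.integral_mono_on (by positivity) (hF.intervalIntegrable _ _) (by simp)
      (fun s hs => hmax hs)
  rw [hintg, intervalIntegral.integral_const, smul_eq_mul, sub_zero] at hle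
  change _ ≤ F t
  calc 3 / Real.pi * (∫ x in (-1 : ℝ)..1, hexG p x) ≤ 3 / Real.pi * (Real.pi / 3 * F t) := by
        gcongr
    _ = F t := by field_simp

open MeasureTheory Set in
lemma hex_hull_bound {p : ℝ} (hp : 1 < p) (q : Fin 6 → ℝ × ℝ)
    (hq : ∀ i, |(q i).1| ^ p + |(q i).2| ^ p = 1) :
    volume (convexHull ℝ (range q)) ≤ ENNReal.ofReal 4 := by
  have hsub : convexHull ℝ (range q) ⊆ Icc (-1) 1 ×ˢ Icc (-1) 1 := by
    refine convexHull_min ?_ ((convex_Icc _ _).prod (convex_Icc _ _))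
    rintro _ ⟨i, rfl⟩
    exact ⟨abs_le.1 (hex_abs_le hp (hq i).le),
      abs_le.1 (hex_abs_le (y := (q i).1) hp (by rw [add_comm]; exact (hq i).le))⟩
  refine (measure_mono hsub).trans ?_
  rw [Measure.volume_eq_prod, Measure.prod_prod, Real.volume_Icc,
    ← ENNReal.ofReal_mul (by norm_num)]
  norm_num

open MeasureTheory Set in
lemma hex_main {p : ℝ} (hp : 1 < p) : ∃ q : Fin 6 → ℝ × ℝ,
    (∀ i, |(q i).1| ^ p + |(q i).2| ^ p = 1) ∧
        3 * Real.sqrt 3 / (2 * Real.pi) *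
            (MeasureTheory.volume {z : ℝ × ℝ | |z.1| ^ p + |z.2| ^ p < 1}).toReal
          ≤ (MeasureTheory.volume (convexHull ℝ (Set.range q))).toReal := by
  have hπ := Real.pi_pos
  have h3 : Real.sqrt 3 * Real.sqrt 3 = 3 := Real.mul_self_sqrt (by norm_num)
  -- abstract parameters
  obtain ⟨a, b, ha, hb, hab, ha1, hle⟩ : ∃ a b : ℝ, 0 ≤ a ∧ 0 ≤ b ∧ b ≤ a ∧ a ≤ 1 ∧
      3 / Real.pi * (∫ x in (-1 : ℝ)..1, hexG p x) * Real.sqrt 3 ≤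
        hexG p a * (a - 2 * b) + hexG p b * (2 * a - b) + hexG p (b - a) * (a + b) := by
    obtain ⟨t, ht0, ht1, ht⟩ := hex_exists hp
    have hs0 : 0 ≤ Real.sin t := Real.sin_nonneg_of_nonneg_of_le_pi ht0 (by linarith)
    have hc0 : 1 / 2 ≤ Real.cos t := by
      rw [← Real.cos_pi_div_three]
      exact Real.cos_le_cos_of_nonneg_of_le_pi ht0 (by linarith) ht1
    have c1 : Real.cos (t + Real.pi / 3) = Real.cos t / 2 - Real.sqrt 3 / 2 * Real.sin t := by
      rw [Real.cos_add, Real.cos_pi_div_three, Real.sin_pi_div_three]; ring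
    have s1 : Real.sin (t + Real.pi / 3) = Real.sin t / 2 + Real.sqrt 3 / 2 * Real.cos t := by
      rw [Real.sin_add, Real.cos_pi_div_three, Real.sin_pi_div_three]; ring
    have e2 : t + 2 * Real.pi / 3 = (t + Real.pi / 3) + Real.pi / 3 := by ring
    have c2 : Real.cos (t + 2 * Real.pi / 3) = Real.cos (t + Real.pi / 3) - Real.cos t := by
      rw [e2, Real.cos_add, Real.cos_pi_div_three, Real.sin_pi_div_three, c1, s1]
      linear_combination (-Real.cos t / 4) * h3
    have s2 : Real.sin (t + 2 * Real.pi / 3) = Real.sin (t + Real.pi / 3) - Real.sin t := by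
      rw [e2, Real.sin_add, Real.cos_pi_div_three, Real.sin_pi_div_three, c1, s1]
      linear_combination (-Real.sin t / 4) * h3
    have hc2 : Real.cos (t + 2 * Real.pi / 3) ≤ -1 / 2 := by
      have : Real.cos (t + 2 * Real.pi / 3) = - Real.cos (Real.pi / 3 - t) := by
        rw [← Real.cos_pi_sub]
        congr 1
        ring
      have h2 : 1 / 2 ≤ Real.cos (Real.pi / 3 - t) := by
        rw [← Real.cos_pi_div_three]
        exact Real.cos_le_cos_of_nonneg_of_le_pi (by linarith) (by linarith) (by linarith)
      linarith
    have hmul := mul_le_mul_of_nonneg_right ht (Real.sqrt_nonneg 3)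
    rw [c2] at hc2
    rw [c2, s2] at hmul
    have hS0 : Real.sin t * Real.sqrt 3 = Real.cos t - 2 * Real.cos (t + Real.pi / 3) := by
      rw [c1]; ring
    have hS1 : Real.sin (t + Real.pi / 3) * Real.sqrt 3
        = 2 * Real.cos t - Real.cos (t + Real.pi / 3) := by
      rw [c1, s1]; linear_combination (Real.cos t / 2) * h3
    generalize Real.cos (t + Real.pi / 3) = B at *
    generalize Real.sin (t + Real.pi / 3) = S at *
    by_cases hB : 0 ≤ B
    · refine ⟨Real.cos t, B, by linarith, hB, by linarith, Real.cos_le_one t, hmul.trans_eq ?_⟩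
      linear_combination (hexG p (Real.cos t) - hexG p (B - Real.cos t)) * hS0
        + (hexG p B + hexG p (B - Real.cos t)) * hS1
    · refine ⟨Real.cos t - B, -B, by linarith, by linarith, by linarith, ?_, hmul.trans_eq ?_⟩
      · have := Real.neg_one_le_cos (t + 2 * Real.pi / 3)
        linarith
      · rw [show -B - (Real.cos t - B) = - Real.cos t by ring, hexG_neg, hexG_neg,
          show Real.cos t - B = -(B - Real.cos t) by ring, hexG_neg]
        linear_combination (hexG p (Real.cos t) - hexG p (B - Real.cos t)) * hS0
          + (hexG p B + hexG p (B - Real.cos t)) * hS1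
  let q : Fin 6 → ℝ × ℝ := ![(a, hexG p a), (b, hexG p b), (b - a, hexG p (b - a)),
    -(a, hexG p a), -(b, hexG p b), -(b - a, hexG p (b - a))]
  have ea := hexG_on (p := p) (x := a) hp (abs_le.2 ⟨by linarith, by linarith⟩)
  have eb := hexG_on (p := p) (x := b) hp (abs_le.2 ⟨by linarith, by linarith⟩)
  have ec := hexG_on (p := p) (x := b - a) hp (abs_le.2 ⟨by linarith, by linarith⟩)
  have hq : ∀ i, |(q i).1| ^ p + |(q i).2| ^ p = 1 := by
    intro i
    fin_cases i
    · exact ea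
    · exact eb
    · exact ec
    · change |-a| ^ p + |-hexG p a| ^ p = 1
      rw [abs_neg, abs_neg]; exact ea
    · change |-b| ^ p + |-hexG p b| ^ p = 1
      rw [abs_neg, abs_neg]; exact eb
    · change |-(b - a)| ^ p + |-hexG p (b - a)| ^ p = 1
      rw [abs_neg, abs_neg]; exact ec
  refine ⟨q, hq, ?_⟩
  have hneg : ∀ x ∈ range q, -x ∈ range q := by
    rintro _ ⟨i, rfl⟩
    fin_cases i
    · exact ⟨3, rfl⟩
    · exact ⟨4, rfl⟩
    · exact ⟨5, rfl⟩
    · exact ⟨0, (neg_neg _).symm⟩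
    · exact ⟨1, (neg_neg _).symm⟩
    · exact ⟨2, (neg_neg _).symm⟩
  have hsub : range q ⊆ convexHull ℝ (range q) := subset_convexHull ℝ _
  have hsym : ∀ x y : ℝ, (x, y) ∈ convexHull ℝ (range q) →
      (-x, -y) ∈ convexHull ℝ (range q) := by
    have : convexHull ℝ (range q) ⊆
        (-LinearMap.id : (ℝ × ℝ) →ₗ[ℝ] (ℝ × ℝ)) ⁻¹' (convexHull ℝ (range q)) := by
      refine convexHull_min ?_ ((convex_convexHull ℝ _).linear_preimage _)
      intro x hx
      exact hsub (hneg x hx)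
    intro x y h
    exact this h
  have harea := hex_area (convex_convexHull ℝ (range q)) hb hab hsym
    (hsub ⟨0, rfl⟩) (hsub ⟨1, rfl⟩) (hsub ⟨2, rfl⟩)
  have hfin : volume (convexHull ℝ (range q)) ≠ ⊤ :=
    ne_top_of_le_ne_top ENNReal.ofReal_ne_top (hex_hull_bound hp q hq)
  have h1 := (ENNReal.ofReal_le_iff_le_toReal hfin).1 harea
  refine le_trans ?_ (hle.trans h1)
  calc _ ≤ 3 * Real.sqrt 3 / (2 * Real.pi) * (2 * ∫ x in (-1 : ℝ)..1, hexG p x) := by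
        gcongr
        exact hex_vol_le hp
    _ = _ := by field_simp

/-- For real `p > 1`, there are six points on the curve
`|x|ᵖ + |y|ᵖ = 1` whose convex hull has area at least `(3√3/(2π))·V(D_p)`;
in particular the maximal area `γ_h(D_p)` of an inscribed hexagon satisfies
`γ_h(D_p) ≥ (3√3/(2π))·V(D_p)`. -/
theorem statement_10 (p : ℝ) (hp : 1 < p) :
    (∃ q : Fin 6 → ℝ × ℝ, (∀ i, |(q i).1| ^ p + |(q i).2| ^ p = 1) ∧
        3 * Real.sqrt 3 / (2 * Real.pi) *
            (MeasureTheory.volume {z : ℝ × ℝ | |z.1| ^ p + |z.2| ^ p < 1}).toReal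
          ≤ (MeasureTheory.volume (convexHull ℝ (Set.range q))).toReal)
    ∧ 3 * Real.sqrt 3 / (2 * Real.pi) *
          (MeasureTheory.volume {z : ℝ × ℝ | |z.1| ^ p + |z.2| ^ p < 1}).toReal
        ≤ sSup {A : ℝ | ∃ q : Fin 6 → ℝ × ℝ,
            (∀ i, |(q i).1| ^ p + |(q i).2| ^ p = 1) ∧
            A = (MeasureTheory.volume (convexHull ℝ (Set.range q))).toReal} := by

  obtain ⟨q, hq, h⟩ := hex_main hp
  refine ⟨⟨q, hq, h⟩, h.trans (le_csSup ⟨4, ?_⟩ ⟨q, hq, rfl⟩)⟩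
  rintro A ⟨r, hr, rfl⟩
  exact ENNReal.toReal_le_of_le_ofReal (by norm_num) (hex_hull_bound hp r hr)
end

section
/- Let p > 1 be real. There exists a lattice Λ in ℝ² such that the translates of the closed Minkowski ball {(x,y) : |x|ᵖ + |y|ᵖ ≤ 1} by the points of Λ cover all of ℝ², and the covering density V(D_p)/d(Λ) satisfies V(D_p)/d(Λ) ≤ 2π/(3√3). In particular the density ϑ(D_p) of the thinnest lattice covering of the plane by D_p satisfies ϑ(D_p) ≤ 2π/(3√3). -/
noncomputable section

/-- The lattice in `ℝ²` spanned over `ℤ` by `u` and `v`. -/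
def latticeOf (u v : ℝ × ℝ) : Set (ℝ × ℝ) := {z | ∃ m k : ℤ, z = m • u + k • v}

/-- The covolume of the lattice with `ℤ`-basis `u`, `v`. -/
def covol (u v : ℝ × ℝ) : ℝ := |u.1 * v.2 - u.2 * v.1|

/-- The lattice with `ℤ`-basis `u`, `v` is a covering lattice of `D_p`: the
translates of the closed Minkowski ball by the lattice points cover `ℝ²`. -/
def IsCoveringLattice (p : ℝ) (u v : ℝ × ℝ) : Prop :=
  covol u v ≠ 0 ∧
    (⋃ b ∈ latticeOf u v,
        (fun x => x + b) '' {z : ℝ × ℝ | |z.1| ^ p + |z.2| ^ p ≤ 1}) = Set.univ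

lemma exists_lam (u v : Fin 3 → ℝ) (hu : ∀ i, 0 ≤ u i) (hv : v 0 + v 1 + v 2 = 1) :
    ∃ l : ℝ, 0 ≤ l ∧ (∀ i, 0 ≤ u i - l * v i) ∧ ∃ i, u i - l * v i = 0 := by
  classical
  have hne : (Finset.univ.filter (fun i => 0 < v i)).Nonempty := by
    by_contra h
    rw [Finset.not_nonempty_iff_eq_empty, Finset.filter_eq_empty_iff] at h
    have h0 := h (Finset.mem_univ 0)
    have h1 := h (Finset.mem_univ 1)
    have h2 := h (Finset.mem_univ 2)
    linarith
  obtain ⟨i, hi, hmin⟩ := Finset.exists_min_image _ (fun i => u i / v i) hne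
  have hvi : 0 < v i := by simpa using hi
  have hl : 0 ≤ u i / v i := div_nonneg (hu i) hvi.le
  refine ⟨u i / v i, hl, fun j => ?_, i, ?_⟩
  · by_cases hj : 0 < v j
    · have := hmin j (by simpa using hj)
      rw [le_div_iff₀ hj] at this
      linarith
    · have := mul_nonneg hl (neg_nonneg.2 (not_lt.1 hj))
      have := hu j
      linarith
  · field_simp
    ring

lemma comb3 {K : Set (ℝ × ℝ)} (hK : Convex ℝ K) {x y z : ℝ × ℝ} (hx : x ∈ K) (hy : y ∈ K)
    (hz : z ∈ K) {r s t : ℝ} (hr : 0 ≤ r) (hs : 0 ≤ s) (ht : 0 ≤ t) (h : r + s + t = 1) :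
    r • x + s • y + t • z ∈ K := by
  have := hK.sum_mem (t := Finset.univ) (w := ![r, s, t]) (z := ![x, y, z])
    (by intro i _; fin_cases i <;> simpa) (by simp [Fin.sum_univ_three, h])
    (by intro i _; fin_cases i <;> simpa)
  simpa [Fin.sum_univ_three] using this

lemma cover {K : Set (ℝ × ℝ)} (hK : Convex ℝ K) (hsymm : ∀ z ∈ K, -z ∈ K) (a b c : ℝ × ℝ)
    (ha : a ∈ K) (hb : b ∈ K) (hc : c ∈ K)
    (hD : (a + b).1 * (b + c).2 - (a + b).2 * (b + c).1 ≠ 0) (z : ℝ × ℝ) :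
    ∃ w ∈ K, ∃ m k : ℤ, w + (m • (a + b) + k • (b + c)) = z := by
  have solve : ∀ z : ℝ × ℝ, ∃ x y : ℝ, z = -b + x • (a + b) + y • (b + c) := by
    intro z
    obtain ⟨D, hDe⟩ : ∃ D, D = (a + b).1 * (b + c).2 - (a + b).2 * (b + c).1 := ⟨_, rfl⟩
    rw [← hDe] at hD
    refine ⟨((z + b).1 * (b + c).2 - (z + b).2 * (b + c).1) / D,
      ((a + b).1 * (z + b).2 - (a + b).2 * (z + b).1) / D, ?_⟩
    simp only [Prod.fst_add, Prod.snd_add] at hDe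
    ext
    · simp only [Prod.fst_add, Prod.snd_add, Prod.fst_neg, Prod.smul_fst, smul_eq_mul]
      field_simp
      rw [hDe]
      ring
    · simp only [Prod.fst_add, Prod.snd_add, Prod.snd_neg, Prod.smul_snd, smul_eq_mul]
      field_simp
      rw [hDe]
      ring
  obtain ⟨x, y, hz⟩ := solve z
  obtain ⟨x', y', hb'⟩ := solve b
  have hx := Int.floor_add_fract x
  have hy := Int.floor_add_fract y
  have hs0 := Int.fract_nonneg x
  have hr0 := Int.fract_nonneg y
  have hs1 := Int.fract_lt_one x
  have hr1 := Int.fract_lt_one y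
  set s := Int.fract x
  set r := Int.fract y
  set m := ⌊x⌋
  set k := ⌊y⌋
  have hz1 := congrArg Prod.fst hz
  have hz2 := congrArg Prod.snd hz
  have hb1 := congrArg Prod.fst hb'
  have hb2 := congrArg Prod.snd hb'
  rw [← hx, ← hy] at hz1 hz2
  simp only [Prod.fst_add, Prod.snd_add, Prod.fst_neg, Prod.snd_neg, Prod.smul_fst,
    Prod.smul_snd, smul_eq_mul] at hz1 hz2 hb1 hb2
  by_cases hsr : s + r ≤ 1
  · refine ⟨(1 - s - r) • (-b) + s • a + r • c,
      comb3 hK (hsymm b hb) ha hc (by linarith) hs0 hr0 (by ring), m, k, ?_⟩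
    ext
    · simp [zsmul_eq_mul]
      linear_combination -hz1
    · simp [zsmul_eq_mul]
      linear_combination -hz2
  · obtain ⟨l, hl, hnn, i, hi⟩ := exists_lam ![1 - r, 1 - s, s + r - 1]
      ![1 - y', 1 - x', x' + y' - 1]
      (by intro i; fin_cases i <;> simp <;> linarith) (by simp; ring)
    have h0 := hnn 0
    have h1 := hnn 1
    have h2 := hnn 2
    simp at h0 h1 h2
    fin_cases i
    · simp at hi
      refine ⟨l • (-c) + (1 - s - l * (1 - x')) • (-b) + (s + r - 1 - l * (x' + y' - 1)) • a,
        comb3 hK (hsymm c hc) (hsymm b hb) ha hl (by linarith) (by linarith) (by linarith),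
        m, k + 1, ?_⟩
      ext
      · simp [zsmul_eq_mul]
        linear_combination -hz1 + l * hb1 - hi * a.1 + hi * (b.1 + c.1)
      · simp [zsmul_eq_mul]
        linear_combination -hz2 + l * hb2 - hi * a.2 + hi * (b.2 + c.2)
    · simp at hi
      refine ⟨l • (-a) + (1 - r - l * (1 - y')) • (-b) + (s + r - 1 - l * (x' + y' - 1)) • c,
        comb3 hK (hsymm a ha) (hsymm b hb) hc hl (by linarith) (by linarith) (by linarith),
        m + 1, k, ?_⟩
      ext
      · simp [zsmul_eq_mul]
        linear_combination -hz1 + l * hb1 - hi * c.1 + hi * (a.1 + b.1)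
      · simp [zsmul_eq_mul]
        linear_combination -hz2 + l * hb2 - hi * c.2 + hi * (a.2 + b.2)
    · simp at hi
      refine ⟨l • b + (1 - r - l * (1 - y')) • a + (1 - s - l * (1 - x')) • c,
        comb3 hK hb ha hc hl (by linarith) (by linarith) (by linarith),
        m, k, ?_⟩
      ext
      · simp [zsmul_eq_mul]
        linear_combination -hz1 + l * hb1 - hi * (a.1 + b.1 + c.1)
      · simp [zsmul_eq_mul]
        linear_combination -hz2 + l * hb2 - hi * (a.2 + b.2 + c.2)

lemma ball_convex (p : ℝ) (hp : 1 < p) :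
    Convex ℝ {z : ℝ × ℝ | |z.1| ^ p + |z.2| ^ p ≤ 1} := by
  have key : ∀ x y s t : ℝ, 0 ≤ s → 0 ≤ t → s + t = 1 →
      |s * x + t * y| ^ p ≤ s * |x| ^ p + t * |y| ^ p := by
    intro x y s t hs ht hst
    have h1 : |s * x + t * y| ≤ s * |x| + t * |y| := by
      refine (abs_add_le _ _).trans ?_
      rw [abs_mul, abs_mul, abs_of_nonneg hs, abs_of_nonneg ht]
    refine (Real.rpow_le_rpow (abs_nonneg _) h1 (by linarith)).trans ?_
    have := (convexOn_rpow hp.le).2 (x := |x|) (y := |y|) (abs_nonneg x) (abs_nonneg y) hs ht hst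
    simpa using this
  intro z hz w hw s t hs ht hst
  simp only [Set.mem_ofPred_eq] at hz hw ⊢
  have h1 := key z.1 w.1 s t hs ht hst
  have h2 := key z.2 w.2 s t hs ht hst
  simp only [Prod.fst_add, Prod.snd_add, Prod.smul_fst, Prod.smul_snd, smul_eq_mul]
  have h3 := mul_le_mul_of_nonneg_left hz hs
  have h4 := mul_le_mul_of_nonneg_left hw ht
  nlinarith

/-- The upper boundary function of the ball. -/
def bdry (p x : ℝ) : ℝ := (1 - |x| ^ p) ^ (1 / p)

lemma bdry_cont (p : ℝ) (hp : 1 < p) : Continuous (bdry p) := by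
  have h0 : 0 < p := by linarith
  unfold bdry
  refine Continuous.rpow_const ?_ (fun _ => Or.inr (by positivity))
  exact continuous_const.sub (continuous_abs.rpow_const (fun _ => Or.inr h0.le))

lemma abs_rpow_le_one {p x : ℝ} (hp : 1 < p) (hx : |x| ≤ 1) : |x| ^ p ≤ 1 :=
  Real.rpow_le_one (abs_nonneg _) hx (by linarith)

lemma bdry_mem (p : ℝ) (hp : 1 < p) (x : ℝ) (hx : |x| ≤ 1) :
    ((x, bdry p x) : ℝ × ℝ) ∈ {z : ℝ × ℝ | |z.1| ^ p + |z.2| ^ p ≤ 1} := by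
  have h := abs_rpow_le_one hp hx
  have h1 : 0 ≤ 1 - |x| ^ p := by linarith
  simp only [Set.mem_ofPred_eq, bdry]
  rw [abs_of_nonneg (Real.rpow_nonneg h1 _), ← Real.rpow_mul h1, one_div_mul_cancel (by linarith),
    Real.rpow_one]
  linarith

lemma mink_eq (p : ℝ) (hp : 1 < p) : {z : ℝ × ℝ | |z.1| ^ p + |z.2| ^ p < 1} =
    regionBetween (fun x => - bdry p x) (bdry p) (Set.Ioc (-1) 1) := by
  have h0 : 0 < p := by linarith
  have key : ∀ x y : ℝ, |x| ≤ 1 → (|y| < bdry p x ↔ |x| ^ p + |y| ^ p < 1) := by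
    intro x y hx
    have h := abs_rpow_le_one hp hx
    have h1 : 0 ≤ 1 - |x| ^ p := by linarith
    unfold bdry
    rw [one_div, Real.lt_rpow_inv_iff_of_pos (abs_nonneg _) h1 h0]
    constructor <;> intro <;> linarith
  ext ⟨x, y⟩
  simp only [Set.mem_ofPred_eq, regionBetween, Set.mem_Ioo, Set.mem_Ioc, ← abs_lt]
  constructor
  · intro h
    have hy : 0 ≤ |y| ^ p := Real.rpow_nonneg (abs_nonneg _) _
    have hx : |x| < 1 := by
      by_contra hx
      have := Real.one_le_rpow (not_lt.1 hx) h0.le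
      linarith
    have hx' := abs_lt.1 hx
    exact ⟨⟨hx'.1, hx'.2.le⟩, (key x y hx.le).2 h⟩
  · rintro ⟨hx, h⟩
    exact (key x y (abs_le.2 ⟨hx.1.le, hx.2⟩)).1 h

lemma vol_eq (p : ℝ) (hp : 1 < p) :
    (MeasureTheory.volume {z : ℝ × ℝ | |z.1| ^ p + |z.2| ^ p < 1}).toReal =
      2 * ∫ x in (-1 : ℝ)..1, bdry p x := by
  have hc := bdry_cont p hp
  have hpos : ∀ x ∈ Set.Ioc (-1 : ℝ) 1, 0 ≤ bdry p x := fun x hx => by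
    have h := abs_rpow_le_one hp (abs_le.2 ⟨hx.1.le, hx.2⟩)
    exact Real.rpow_nonneg (by linarith) _
  rw [mink_eq p hp, MeasureTheory.Measure.volume_eq_prod,
    volume_regionBetween_eq_integral (f := fun x => - bdry p x) (hc.neg.integrableOn_Ioc) (hc.integrableOn_Ioc)
      measurableSet_Ioc (fun x hx => by have := hpos x hx; linarith), ENNReal.toReal_ofReal]
  · rw [intervalIntegral.integral_of_le (by norm_num), ← MeasureTheory.integral_const_mul]
    congr 1
    ext x
    simp
    ring
  · refine MeasureTheory.setIntegral_nonneg measurableSet_Ioc (fun x hx => ?_)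
    have := hpos x hx
    simp
    linarith

lemma vol_pos (p : ℝ) (hp : 1 < p) :
    0 < (MeasureTheory.volume {z : ℝ × ℝ | |z.1| ^ p + |z.2| ^ p < 1}).toReal := by
  have hc := bdry_cont p hp
  rw [vol_eq p hp]
  have : 0 < ∫ x in (-1 : ℝ)..1, bdry p x := by
    refine intervalIntegral.intervalIntegral_pos_of_pos_on (hc.intervalIntegrable _ _) ?_
      (by norm_num)
    intro x hx
    have := Real.rpow_lt_one (abs_nonneg x) (abs_lt.2 hx) (by linarith : 0 < p)
    exact Real.rpow_pos_of_pos (by linarith) _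
  linarith

lemma exists_hex (p : ℝ) (hp : 1 < p) : ∃ t : ℝ,
    3 * Real.sqrt 3 / (2 * Real.pi) *
      (MeasureTheory.volume {z : ℝ × ℝ | |z.1| ^ p + |z.2| ^ p < 1}).toReal ≤
    Real.sqrt 3 * (bdry p (Real.cos t) * Real.sin t +
      bdry p (Real.cos (t + Real.pi / 3)) * Real.sin (t + Real.pi / 3) +
      bdry p (Real.cos (t + 2 * Real.pi / 3)) * Real.sin (t + 2 * Real.pi / 3)) := by
  have hc := bdry_cont p hp
  have hpi := Real.pi_pos
  set F : ℝ → ℝ := fun t => bdry p (Real.cos t) * Real.sin t with hF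
  have hFc : Continuous F := (hc.comp Real.continuous_cos).mul Real.continuous_sin
  have hint : ∫ t in (0 : ℝ)..Real.pi, F t = ∫ x in (-1 : ℝ)..1, bdry p x := by
    have := intervalIntegral.integral_comp_mul_deriv (a := 0) (b := Real.pi) (f := Real.cos)
      (f' := fun x => - Real.sin x) (g := bdry p) (fun x _ => Real.hasDerivAt_cos x)
      (Real.continuous_sin.neg.continuousOn) hc
    rw [Real.cos_zero, Real.cos_pi, intervalIntegral.integral_symm (-1) 1] at this
    rw [← neg_inj, ← this, ← intervalIntegral.integral_neg]
    congr 1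
    ext t
    simp [hF]
  have hsum : ∫ t in (0 : ℝ)..(Real.pi / 3),
      (F t + F (t + Real.pi / 3) + F (t + 2 * Real.pi / 3)) = ∫ x in (-1 : ℝ)..1, bdry p x := by
    have c1 : Continuous fun t => F (t + Real.pi / 3) := by fun_prop
    have c01 : Continuous fun t => F t + F (t + Real.pi / 3) := hFc.add c1
    have c2 : Continuous fun t => F (t + 2 * Real.pi / 3) := by fun_prop
    rw [intervalIntegral.integral_add (c01.intervalIntegrable _ _)
      (c2.intervalIntegrable _ _), intervalIntegral.integral_add (hFc.intervalIntegrable _ _)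
      (c1.intervalIntegrable _ _), intervalIntegral.integral_comp_add_right,
      intervalIntegral.integral_comp_add_right, ← hint,
      show (0 : ℝ) + Real.pi / 3 = Real.pi / 3 by ring,
      show (0 : ℝ) + 2 * Real.pi / 3 = Real.pi / 3 + Real.pi / 3 by ring,
      show Real.pi / 3 + 2 * Real.pi / 3 = Real.pi by ring,
      intervalIntegral.integral_add_adjacent_intervals (hFc.intervalIntegrable _ _)
        (hFc.intervalIntegrable _ _),
      intervalIntegral.integral_add_adjacent_intervals (hFc.intervalIntegrable _ _)
        (hFc.intervalIntegrable _ _)]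
  have h3 : 0 < Real.sqrt 3 := by positivity
  rw [vol_eq p hp]
  set I := ∫ x in (-1 : ℝ)..1, bdry p x
  by_contra! hcon
  have hlt : ∀ t, F t + F (t + Real.pi / 3) + F (t + 2 * Real.pi / 3) < 3 / Real.pi * I := by
    intro t
    have := hcon t
    have e : 3 * Real.sqrt 3 / (2 * Real.pi) * (2 * I) = Real.sqrt 3 * (3 / Real.pi * I) := by
      field_simp
    rw [e] at this
    exact lt_of_mul_lt_mul_left this h3.le
  have hG : Continuous fun t => F t + F (t + Real.pi / 3) + F (t + 2 * Real.pi / 3) := by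
    fun_prop
  have := intervalIntegral.integral_lt_integral_of_continuousOn_of_le_of_exists_lt
    (a := 0) (b := Real.pi / 3) (by positivity) hG.continuousOn
    (continuousOn_const (c := 3 / Real.pi * I)) (fun t _ => (hlt t).le)
    ⟨0, ⟨le_refl _, by positivity⟩, hlt 0⟩
  rw [hsum, intervalIntegral.integral_const, smul_eq_mul] at this
  have e : (Real.pi / 3 - 0) * (3 / Real.pi * I) = I := by field_simp; ring
  rw [e] at this
  exact lt_irrefl _ this

lemma main_exists (p : ℝ) (hp : 1 < p) :
    ∃ u v : ℝ × ℝ, IsCoveringLattice p u v ∧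
        (MeasureTheory.volume {z : ℝ × ℝ | |z.1| ^ p + |z.2| ^ p < 1}).toReal / covol u v
          ≤ 2 * Real.pi / (3 * Real.sqrt 3) := by
  obtain ⟨t, ht⟩ := exists_hex p hp
  have hV := vol_pos p hp
  set V := (MeasureTheory.volume {z : ℝ × ℝ | |z.1| ^ p + |z.2| ^ p < 1}).toReal
  have hpi := Real.pi_pos
  have h3 : 0 < Real.sqrt 3 := by positivity
  have h33 : Real.sqrt 3 * Real.sqrt 3 = 3 := Real.mul_self_sqrt (by norm_num)
  set P : ℝ → ℝ × ℝ := fun s => (Real.cos s, bdry p (Real.cos s)) with hP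
  have hmem : ∀ s, P s ∈ {z : ℝ × ℝ | |z.1| ^ p + |z.2| ^ p ≤ 1} := fun s =>
    bdry_mem p hp _ (Real.abs_cos_le_one s)
  set a := P t with ha
  set b := P (t + Real.pi / 3) with hb
  set c := P (t + 2 * Real.pi / 3) with hc
  have e2 : (2 * Real.pi / 3) = Real.pi - Real.pi / 3 := by ring
  have hdet : (a + b).1 * (b + c).2 - (a + b).2 * (b + c).1 =
      Real.sqrt 3 * (bdry p (Real.cos t) * Real.sin t +
      bdry p (Real.cos (t + Real.pi / 3)) * Real.sin (t + Real.pi / 3) +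
      bdry p (Real.cos (t + 2 * Real.pi / 3)) * Real.sin (t + 2 * Real.pi / 3)) := by
    simp only [ha, hb, hc, hP, Prod.fst_add, Prod.snd_add]
    generalize bdry p (Real.cos t) = h0
    generalize bdry p (Real.cos (t + Real.pi / 3)) = h1
    generalize bdry p (Real.cos (t + 2 * Real.pi / 3)) = h2
    rw [e2]
    simp only [Real.cos_add, Real.sin_add, Real.cos_pi_sub, Real.sin_pi_sub, Real.cos_pi_div_three,
      Real.sin_pi_div_three]
    linear_combination (-(1 / 2) * Real.cos t * (h1 + h2)) * h33
  have hpos : 0 < (a + b).1 * (b + c).2 - (a + b).2 * (b + c).1 := by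
    rw [hdet]
    refine lt_of_lt_of_le ?_ ht
    positivity
  refine ⟨a + b, b + c, ⟨?_, ?_⟩, ?_⟩
  · unfold covol
    exact abs_ne_zero.2 hpos.ne'
  · refine Set.eq_univ_of_forall (fun z => ?_)
    obtain ⟨w, hw, m, k, h⟩ := cover (ball_convex p hp) (fun z hz => by simpa using hz) a b c
      (hmem _) (hmem _) (hmem _) hpos.ne' z
    exact Set.mem_iUnion₂.2 ⟨m • (a + b) + k • (b + c), ⟨m, k, rfl⟩, w, hw, h⟩
  · unfold covol
    rw [abs_of_pos hpos, div_le_iff₀ hpos, hdet]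
    calc V = 2 * Real.pi / (3 * Real.sqrt 3) * (3 * Real.sqrt 3 / (2 * Real.pi) * V) := by
          field_simp
      _ ≤ _ := mul_le_mul_of_nonneg_left ht (by positivity)

/-- For real `p > 1`, there is a lattice `Λ` whose translates of
the closed Minkowski ball cover the plane with density
`V(D_p)/d(Λ) ≤ 2π/(3√3)`; in particular the density of the thinnest lattice
covering by `D_p` satisfies `ϑ(D_p) ≤ 2π/(3√3)`. -/
theorem statement_11 (p : ℝ) (hp : 1 < p) :
    (∃ u v : ℝ × ℝ, IsCoveringLattice p u v ∧
        (MeasureTheory.volume {z : ℝ × ℝ | |z.1| ^ p + |z.2| ^ p < 1}).toReal / covol u v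
          ≤ 2 * Real.pi / (3 * Real.sqrt 3))
    ∧ sInf {d : ℝ | ∃ u v : ℝ × ℝ, IsCoveringLattice p u v ∧
          d = (MeasureTheory.volume {z : ℝ × ℝ | |z.1| ^ p + |z.2| ^ p < 1}).toReal /
            covol u v}
        ≤ 2 * Real.pi / (3 * Real.sqrt 3) := by
  obtain ⟨u, v, huv, h⟩ := main_exists p hp
  refine ⟨⟨u, v, huv, h⟩, le_trans (csInf_le ⟨0, ?_⟩ ⟨u, v, huv, rfl⟩) h⟩
  rintro d ⟨u, v, -, rfl⟩
  exact div_nonneg ENNReal.toReal_nonneg (abs_nonneg _)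

end
end

section
/- Let p > 1 be real, set σ_p = (2ᵖ − 1)^{1/p}, let τ_p be the unique real in [0, 1) with 2(1 − τ_p)ᵖ = 1 + τ_pᵖ, and let p₀ (2.57 < p₀ < 2.58) be the unique real with σ_{p₀}/2 = 4^{−1/p₀}(1 + τ_{p₀})/(1 − τ_{p₀}). Define I(p) = (3/2)·σ_p for 1 < p ≤ 2 and for p ≥ p₀, and I(p) = 3·4^{−1/p}·(1 + τ_p)/(1 − τ_p) for 2 ≤ p ≤ p₀. Then there exists a lattice Λ admissible for D_p with a ℤ-basis u, v such that u, v, u + v all lie on the curve |x|ᵖ + |y|ᵖ = 1 and the area of the hexagon conv{±u, ±v, ±(u + v)} is at least I(p); consequently the covering constant Γ(D_p), the supremum of areas of such inscribed hexagons of admissible lattices, satisfies Γ(D_p) ≥ I(p). -/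
noncomputable section

/-- The lattice with `ℤ`-basis `u`, `v` is admissible for `D_p`. -/
def IsAdmissible (p : ℝ) (u v : ℝ × ℝ) : Prop :=
  covol u v ≠ 0 ∧ ∀ z ∈ latticeOf u v, z ≠ 0 → 1 ≤ |z.1| ^ p + |z.2| ^ p

/-- The area of the al-hexagon `conv{±u, ±v, ±(u+v)}`. -/
def hexArea (u v : ℝ × ℝ) : ℝ :=
  (MeasureTheory.volume (convexHull ℝ ({u, v, u + v, -u, -v, -(u + v)} : Set (ℝ × ℝ)))).toReal

/-- The `p`-norm on the plane. -/
def pN (p : ℝ) (z : ℝ × ℝ) : ℝ := (|z.1| ^ p + |z.2| ^ p) ^ (1 / p)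

lemma pN_add (p : ℝ) (hp : 1 < p) (z w : ℝ × ℝ) : pN p (z + w) ≤ pN p z + pN p w := by
  have h := Real.Lp_add_le (Finset.univ : Finset (Fin 2)) ![z.1, z.2] ![w.1, w.2] hp.le
  simpa [pN, Fin.sum_univ_two] using h

lemma pN_smul (p : ℝ) (hp : 1 < p) (c : ℝ) (z : ℝ × ℝ) : pN p (c • z) = |c| * pN p z := by
  have h1 : |c * z.1| ^ p + |c * z.2| ^ p = |c| ^ p * (|z.1| ^ p + |z.2| ^ p) := by
    rw [abs_mul, abs_mul, Real.mul_rpow (abs_nonneg _) (abs_nonneg _),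
      Real.mul_rpow (abs_nonneg _) (abs_nonneg _)]
    ring
  simp only [pN, Prod.smul_fst, Prod.smul_snd, smul_eq_mul]
  rw [h1, Real.mul_rpow (by positivity) (by positivity), ← Real.rpow_mul (abs_nonneg _),
    mul_one_div_cancel (by linarith), Real.rpow_one]

lemma pN_neg (p : ℝ) (z : ℝ × ℝ) : pN p (-z) = pN p z := by
  simp [pN]

lemma pN_of_eq (p : ℝ) (z : ℝ × ℝ) (h : |z.1| ^ p + |z.2| ^ p = 1) : pN p z = 1 := by
  simp [pN, h]

lemma key1 (p : ℝ) (hp : 1 < p) (e f : ℝ × ℝ) (he : pN p e = 1)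
    (hd : pN p (e - f) = 1) (a b : ℝ) (ha : 0 ≤ a) (hb : 0 ≤ b) :
    a ≤ pN p (a • e + b • f) := by
  have h := pN_add p hp (a • e + b • f) (b • (e - f))
  have h2 : a • e + b • f + b • (e - f) = (a + b) • e := by module
  rw [h2, pN_smul p hp, pN_smul p hp, he, hd, abs_of_nonneg hb, abs_of_nonneg (by linarith)] at h
  linarith

lemma key (p : ℝ) (hp : 1 < p) (e f : ℝ × ℝ) (he : pN p e = 1) (hf : pN p f = 1)
    (hd : pN p (e - f) = 1) (a b : ℝ) (ha : 0 ≤ a) (hb : 0 ≤ b) (h : 1 ≤ a ∨ 1 ≤ b) :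
    1 ≤ pN p (a • e + b • f) := by
  have h1 := key1 p hp e f he hd a b ha hb
  have h2 := key1 p hp f e hf (by rw [← pN_neg, neg_sub]; exact hd) b a hb ha
  rw [add_comm] at h2
  rcases h with h | h <;> linarith

lemma admissible (p : ℝ) (hp : 1 < p) (u v : ℝ × ℝ) (hc : covol u v ≠ 0)
    (hu : |u.1| ^ p + |u.2| ^ p = 1) (hv : |v.1| ^ p + |v.2| ^ p = 1)
    (hw : |(u + v).1| ^ p + |(u + v).2| ^ p = 1) : IsAdmissible p u v := by
  refine ⟨hc, ?_⟩
  rintro z ⟨m, k, rfl⟩ hz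
  have hu := pN_of_eq p u hu
  have hv := pN_of_eq p v hv
  have hw := pN_of_eq p (u + v) hw
  have hmk : ¬ (m = 0 ∧ k = 0) := by
    rintro ⟨rfl, rfl⟩
    simp at hz
  have main : 1 ≤ pN p (m • u + k • v) := by
    -- nonnegative first coordinate
    have pos : ∀ m k : ℤ, ¬ (m = 0 ∧ k = 0) → 0 ≤ m → 1 ≤ pN p (m • u + k • v) := by
      intro m k hmk hm
      rcases le_total 0 k with hk | hk
      · rcases le_total m k with h | h
        · have h3 := key p hp (u + v) v hw hv (by rw [add_sub_cancel_right]; exact hu)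
            (m : ℝ) ((k - m : ℤ) : ℝ) (by exact_mod_cast hm) (by exact_mod_cast (by omega))
            (by
              have : 1 ≤ m ∨ 1 ≤ k - m := by omega
              rcases this with h | h
              · left; exact_mod_cast h
              · right; exact_mod_cast h)
          convert h3 using 2
          push_cast
          module
        · have h3 := key p hp (u + v) u hw hu (by rw [add_sub_cancel_left]; exact hv)
            (k : ℝ) ((m - k : ℤ) : ℝ) (by exact_mod_cast hk) (by exact_mod_cast (by omega))
            (by
              have : 1 ≤ k ∨ 1 ≤ m - k := by omega
              rcases this with h | h
              · left; exact_mod_cast h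
              · right; exact_mod_cast h)
          convert h3 using 2
          push_cast
          module
      · have h3 := key p hp u (-v) hu (by rw [pN_neg]; exact hv) (by rw [sub_neg_eq_add]; exact hw)
          (m : ℝ) ((-k : ℤ) : ℝ) (by exact_mod_cast hm) (by exact_mod_cast (by omega))
          (by
            have : 1 ≤ m ∨ 1 ≤ -k := by omega
            rcases this with h | h
            · left; exact_mod_cast h
            · right; exact_mod_cast h)
        convert h3 using 2
        push_cast
        module
    rcases le_total 0 m with hm | hm
    · exact pos m k hmk hm
    · have h := pos (-m) (-k) (by omega) (by omega)
      rw [← pN_neg]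
      convert h using 2
      module
  by_contra hlt
  push Not at hlt
  have : pN p (m • u + k • v) < 1 :=
    Real.rpow_lt_one (by positivity) hlt (by positivity)
  linarith

/-- The standard hexagon. -/
def stdHex : Set (ℝ × ℝ) :=
  convexHull ℝ ({(1, 0), (0, 1), (1, 1), (-1, 0), (0, -1), (-1, -1)} : Set (ℝ × ℝ))

lemma stdHex_comb (e f : ℝ × ℝ) (he : e ∈ stdHex) (hf : f ∈ stdHex) (a b : ℝ)
    (ha : 0 ≤ a) (hb : 0 ≤ b) (hab : a + b ≤ 1) : a • e + b • f ∈ stdHex := by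
  have hc : Convex ℝ stdHex := convex_convexHull _ _
  have h1 : ((1 : ℝ), (0 : ℝ)) ∈ stdHex := subset_convexHull _ _ (by simp)
  have h2 : ((-1 : ℝ), (0 : ℝ)) ∈ stdHex := subset_convexHull _ _ (by simp)
  have h0 : (0 : ℝ × ℝ) ∈ stdHex := by
    have := hc h1 h2 (by norm_num : (0 : ℝ) ≤ 1 / 2) (by norm_num : (0 : ℝ) ≤ 1 / 2) (by norm_num)
    convert this using 1
    ext <;> simp
  rcases eq_or_lt_of_le (add_nonneg ha hb) with h | h
  · have : a = 0 := by linarith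
    have : b = 0 := by linarith
    subst a b
    simpa using h0
  · have h3 : (a / (a + b)) • e + (b / (a + b)) • f ∈ stdHex :=
      hc he hf (by positivity) (by positivity) (by field_simp)
    have h4 := hc h3 h0 h.le (by linarith : 0 ≤ 1 - (a + b)) (by ring)
    convert h4 using 1
    rw [smul_zero, add_zero, smul_add, smul_smul, smul_smul, mul_div_cancel₀ _ h.ne',
      mul_div_cancel₀ _ h.ne']

lemma stdHex_mem (x y : ℝ) (hx : x ≤ 1) (hx' : -1 ≤ x) (hy : y ≤ 1) (hy' : -1 ≤ y)
    (h : y ≤ x + 1) (h' : x - 1 ≤ y) : (x, y) ∈ stdHex := by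
  have e1 : ((1 : ℝ), (0 : ℝ)) ∈ stdHex := subset_convexHull _ _ (by simp)
  have e2 : ((0 : ℝ), (1 : ℝ)) ∈ stdHex := subset_convexHull _ _ (by simp)
  have e3 : ((1 : ℝ), (1 : ℝ)) ∈ stdHex := subset_convexHull _ _ (by simp)
  have e4 : ((-1 : ℝ), (0 : ℝ)) ∈ stdHex := subset_convexHull _ _ (by simp)
  have e5 : ((0 : ℝ), (-1 : ℝ)) ∈ stdHex := subset_convexHull _ _ (by simp)
  have e6 : ((-1 : ℝ), (-1 : ℝ)) ∈ stdHex := subset_convexHull _ _ (by simp)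
  rcases le_total 0 x with a | a <;> rcases le_total 0 y with b | b
  · rcases le_total x y with c | c
    · have := stdHex_comb _ _ e3 e2 x (y - x) a (by linarith) (by linarith)
      simpa using this
    · have := stdHex_comb _ _ e3 e1 y (x - y) b (by linarith) (by linarith)
      simpa using this
  · have := stdHex_comb _ _ e1 e5 x (-y) a (by linarith) (by linarith)
    simpa using this
  · have := stdHex_comb _ _ e4 e2 (-x) y (by linarith) b (by linarith)
    simpa using this
  · rcases le_total x y with c | c
    · have := stdHex_comb _ _ e6 e4 (-y) (y - x) (by linarith) (by linarith) (by linarith)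
      simpa using this
    · have := stdHex_comb _ _ e6 e5 (-x) (x - y) (by linarith) (by linarith) (by linarith)
      simpa using this

lemma integral_aux : ∫ x in (-1 : ℝ)..1, (2 - |x|) = 3 := by
  have hi : ∀ a b : ℝ, IntervalIntegrable (fun x : ℝ => 2 - |x|) MeasureTheory.volume a b :=
    fun a b => (by fun_prop : Continuous fun x : ℝ => 2 - |x|).intervalIntegrable a b
  rw [← intervalIntegral.integral_add_adjacent_intervals (hi (-1) 0) (hi 0 1)]
  have h1 : ∫ x in (-1 : ℝ)..0, (2 - |x|) = ∫ x in (-1 : ℝ)..0, (2 + x) := by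
    apply intervalIntegral.integral_congr
    intro x hx
    rw [Set.uIcc_of_le (by norm_num)] at hx
    simp only [abs_of_nonpos hx.2, sub_neg_eq_add]
  have h2 : ∫ x in (0 : ℝ)..1, (2 - |x|) = ∫ x in (0 : ℝ)..1, (2 - x) := by
    apply intervalIntegral.integral_congr
    intro x hx
    rw [Set.uIcc_of_le (by norm_num)] at hx
    simp only [abs_of_nonneg hx.1]
  rw [h1, h2, intervalIntegral.integral_add (by simp) (by simp),
    intervalIntegral.integral_sub (by simp) (by simp)]
  norm_num

lemma stdHex_volume : ENNReal.ofReal 3 ≤ MeasureTheory.volume stdHex := by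
  have hsub : regionBetween (fun x : ℝ => max (-1) (x - 1)) (fun x => min 1 (x + 1))
      (Set.Ioc (-1) 1) ⊆ stdHex := by
    rintro ⟨x, y⟩ ⟨hx, hy⟩
    simp only [Set.mem_Ioo, max_lt_iff, lt_min_iff] at hy
    exact stdHex_mem x y hx.2 hx.1.le hy.2.1.le hy.1.1.le hy.2.2.le hy.1.2.le
  refine le_trans (le_of_eq ?_) (MeasureTheory.measure_mono hsub)
  have hcf : Continuous (fun x : ℝ => max (-1) (x - 1)) := by fun_prop
  have hcg : Continuous (fun x : ℝ => min 1 (x + 1)) := by fun_prop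
  rw [MeasureTheory.Measure.volume_eq_prod, volume_regionBetween_eq_integral
    (hcf.integrableOn_Ioc) (hcg.integrableOn_Ioc) measurableSet_Ioc]
  · rw [← intervalIntegral.integral_of_le (by norm_num), ← integral_aux]
    congr 2
    ext x
    simp only [Pi.sub_apply]
    rcases le_total 0 x with h | h
    · rw [abs_of_nonneg h, min_eq_left (by linarith), max_eq_right (by linarith)]; ring
    · rw [abs_of_nonpos h, min_eq_right (by linarith), max_eq_left (by linarith)]; ring
  · intro x hx
    simp only [Set.mem_Ioc] at hx
    simp only [max_le_iff, le_min_iff]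
    refine ⟨⟨?_, ?_⟩, ?_, ?_⟩ <;> linarith

lemma hull_sub (p : ℝ) (hp : 1 < p) (u v : ℝ × ℝ)
    (hu : |u.1| ^ p + |u.2| ^ p = 1) (hv : |v.1| ^ p + |v.2| ^ p = 1)
    (hw : |(u + v).1| ^ p + |(u + v).2| ^ p = 1) :
    convexHull ℝ ({u, v, u + v, -u, -v, -(u + v)} : Set (ℝ × ℝ))
      ⊆ Set.Icc (-1) 1 ×ˢ Set.Icc (-1) 1 := by
  have hb : ∀ z : ℝ × ℝ, |z.1| ^ p + |z.2| ^ p = 1 → |z.1| ≤ 1 ∧ |z.2| ≤ 1 := by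
    intro z hz
    have h1 : 0 ≤ |z.1| ^ p := by positivity
    have h2 : 0 ≤ |z.2| ^ p := by positivity
    constructor <;> by_contra hc <;> push Not at hc <;>
      have := Real.one_lt_rpow hc (by linarith : 0 < p) <;> linarith
  apply convexHull_min
  · have hu := hb _ hu
    have hv := hb _ hv
    have hw := hb _ hw
    simp only [abs_le, Prod.fst_add, Prod.snd_add] at hu hv hw
    intro z hz
    simp only [Set.mem_insert_iff, Set.mem_singleton_iff] at hz
    rcases hz with rfl | rfl | rfl | rfl | rfl | rfl <;>
      simp only [Set.mem_prod, Set.mem_Icc, Prod.fst_add, Prod.snd_add, Prod.fst_neg,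
        Prod.snd_neg] <;>
      refine ⟨⟨?_, ?_⟩, ?_, ?_⟩ <;> linarith
  · exact (convex_Icc _ _).prod (convex_Icc _ _)

lemma square_vol : MeasureTheory.volume (Set.Icc (-1 : ℝ) 1 ×ˢ Set.Icc (-1 : ℝ) 1)
    = ENNReal.ofReal 4 := by
  rw [MeasureTheory.Measure.volume_eq_prod, MeasureTheory.Measure.prod_prod, Real.volume_Icc,
    ← ENNReal.ofReal_mul (by norm_num)]
  norm_num

lemma hexArea_le (p : ℝ) (hp : 1 < p) (u v : ℝ × ℝ)
    (hu : |u.1| ^ p + |u.2| ^ p = 1) (hv : |v.1| ^ p + |v.2| ^ p = 1)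
    (hw : |(u + v).1| ^ p + |(u + v).2| ^ p = 1) : hexArea u v ≤ 4 := by
  have h := MeasureTheory.measure_mono (μ := MeasureTheory.volume) (hull_sub p hp u v hu hv hw)
  rw [square_vol] at h
  exact ENNReal.toReal_le_of_le_ofReal (by norm_num) h

lemma le_hexArea (p : ℝ) (hp : 1 < p) (u v : ℝ × ℝ)
    (hu : |u.1| ^ p + |u.2| ^ p = 1) (hv : |v.1| ^ p + |v.2| ^ p = 1)
    (hw : |(u + v).1| ^ p + |(u + v).2| ^ p = 1) : 3 * covol u v ≤ hexArea u v := by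
  have h := MeasureTheory.measure_mono (μ := MeasureTheory.volume) (hull_sub p hp u v hu hv hw)
  rw [square_vol] at h
  have hfin := (lt_of_le_of_lt h ENNReal.ofReal_lt_top).ne
  set M : Matrix (Fin 2) (Fin 2) ℝ := !![u.1, v.1; u.2, v.2] with hM
  set L := Matrix.toLin (Module.Basis.finTwoProd ℝ) (Module.Basis.finTwoProd ℝ) M with hL
  have hdet : LinearMap.det L = u.1 * v.2 - u.2 * v.1 := by
    rw [hL, LinearMap.det_toLin, hM, Matrix.det_fin_two_of]
    ring
  have happ : ∀ x y : ℝ, L (x, y) = x • u + y • v := by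
    intro x y
    rw [hL, hM, Matrix.toLin_finTwoProd_apply]
    ext <;> simp <;> ring
  have himg : L '' stdHex
      = convexHull ℝ ({u, v, u + v, -u, -v, -(u + v)} : Set (ℝ × ℝ)) := by
    rw [stdHex, LinearMap.image_convexHull]
    congr 1
    simp only [Set.image_insert_eq, Set.image_singleton, happ]
    simp [add_comm]
  rw [hexArea]
  rw [← himg] at hfin ⊢
  rw [MeasureTheory.Measure.addHaar_image_linearMap, hdet] at hfin ⊢
  rw [← ENNReal.ofReal_le_iff_le_toReal hfin, mul_comm, covol, ENNReal.ofReal_mul (abs_nonneg _)]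
  gcongr
  exact stdHex_volume

lemma wrap (p : ℝ) (hp : 1 < p) (I : ℝ) (u v : ℝ × ℝ) (hc : covol u v ≠ 0)
    (hu : |u.1| ^ p + |u.2| ^ p = 1) (hv : |v.1| ^ p + |v.2| ^ p = 1)
    (hw : |(u + v).1| ^ p + |(u + v).2| ^ p = 1) (hI : I = 3 * covol u v) :
    (∃ u v : ℝ × ℝ, IsAdmissible p u v ∧
        |u.1| ^ p + |u.2| ^ p = 1 ∧ |v.1| ^ p + |v.2| ^ p = 1 ∧
        |(u + v).1| ^ p + |(u + v).2| ^ p = 1 ∧ I ≤ hexArea u v)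
    ∧ I ≤ sSup {A : ℝ | ∃ u v : ℝ × ℝ, IsAdmissible p u v ∧
          |u.1| ^ p + |u.2| ^ p = 1 ∧ |v.1| ^ p + |v.2| ^ p = 1 ∧
          |(u + v).1| ^ p + |(u + v).2| ^ p = 1 ∧ A = hexArea u v} := by
  have had := admissible p hp u v hc hu hv hw
  have hle : I ≤ hexArea u v := hI ▸ le_hexArea p hp u v hu hv hw
  refine ⟨⟨u, v, had, hu, hv, hw, hle⟩, hle.trans (le_csSup ?_ ⟨u, v, had, hu, hv, hw, rfl⟩)⟩
  refine ⟨4, ?_⟩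
  rintro A ⟨u, v, -, hu, hv, hw, rfl⟩
  exact hexArea_le p hp u v hu hv hw

/-- with `σ_p = (2ᵖ-1)^(1/p)`, `τ_p ∈ [0,1)` the root of
`2(1-τ)ᵖ = 1+τᵖ`, `p₀ ∈ (2.57, 2.58)` the root of
`σ_{p₀}/2 = 4^(-1/p₀)(1+τ_{p₀})/(1-τ_{p₀})`, and
`I(p) = (3/2)σ_p` for `1 < p ≤ 2` or `p ≥ p₀`,
`I(p) = 3·4^(-1/p)(1+τ_p)/(1-τ_p)` for `2 ≤ p ≤ p₀`:
there is a lattice admissible for `D_p` with a `ℤ`-basis `u`, `v` such that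
`u`, `v`, `u+v` lie on the curve `|x|ᵖ + |y|ᵖ = 1` and the inscribed hexagon
`conv{±u, ±v, ±(u+v)}` has area at least `I(p)`; hence the covering constant
`Γ(D_p)` (the supremum of such hexagon areas) satisfies `Γ(D_p) ≥ I(p)`. -/
theorem statement_13 (p : ℝ) (hp : 1 < p)
    (τ : ℝ → ℝ)
    (hτ : ∀ q : ℝ, 1 ≤ q →
        0 ≤ τ q ∧ τ q < 1 ∧ 2 * (1 - τ q) ^ q = 1 + τ q ^ q)
    (hτuniq : ∀ q : ℝ, 1 ≤ q → ∀ t : ℝ, 0 ≤ t → t < 1 →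
        2 * (1 - t) ^ q = 1 + t ^ q → t = τ q)
    (p₀ : ℝ) (hp₀l : 2.57 < p₀) (hp₀r : p₀ < 2.58)
    (hp₀eq : ((2 : ℝ) ^ p₀ - 1) ^ (1 / p₀) / 2
        = (4 : ℝ) ^ (-(1 / p₀)) * (1 + τ p₀) / (1 - τ p₀))
    (hp₀uniq : ∀ q : ℝ, 2.57 < q → q < 2.58 →
        ((2 : ℝ) ^ q - 1) ^ (1 / q) / 2
          = (4 : ℝ) ^ (-(1 / q)) * (1 + τ q) / (1 - τ q) → q = p₀)
    (I : ℝ)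
    (hI₀ : ((1 < p ∧ p ≤ 2) ∨ p₀ ≤ p) → I = 3 / 2 * ((2 : ℝ) ^ p - 1) ^ (1 / p))
    (hI₁ : (2 ≤ p ∧ p ≤ p₀) → I = 3 * (4 : ℝ) ^ (-(1 / p)) * (1 + τ p) / (1 - τ p)) :
    (∃ u v : ℝ × ℝ, IsAdmissible p u v ∧
        |u.1| ^ p + |u.2| ^ p = 1 ∧ |v.1| ^ p + |v.2| ^ p = 1 ∧
        |(u + v).1| ^ p + |(u + v).2| ^ p = 1 ∧ I ≤ hexArea u v)
    ∧ I ≤ sSup {A : ℝ | ∃ u v : ℝ × ℝ, IsAdmissible p u v ∧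
          |u.1| ^ p + |u.2| ^ p = 1 ∧ |v.1| ^ p + |v.2| ^ p = 1 ∧
          |(u + v).1| ^ p + |(u + v).2| ^ p = 1 ∧ A = hexArea u v} := by
  have hp0 : p ≠ 0 := by linarith
  by_cases hcase : p ≤ 2 ∨ p₀ ≤ p
  · have hI := hI₀ (hcase.imp_left fun h => ⟨hp, h⟩)
    have h2p : (1 : ℝ) < 2 ^ p := Real.one_lt_rpow (by norm_num) (by linarith)
    set s := ((2 : ℝ) ^ p - 1) ^ (1 / p) with hs
    have hspos : 0 < s := Real.rpow_pos_of_pos (by linarith) _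
    have hsp : s ^ p = 2 ^ p - 1 := by
      rw [hs, ← Real.rpow_mul (by linarith), one_div_mul_cancel hp0, Real.rpow_one]
    have hhalf : |(1 / 2 : ℝ)| ^ p + |s / 2| ^ p = 1 := by
      rw [abs_of_pos (by positivity), abs_of_pos (by positivity),
        Real.div_rpow (by norm_num) (by norm_num), Real.div_rpow hspos.le (by norm_num), hsp,
        Real.one_rpow, ← add_div]
      rw [div_eq_one_iff_eq (by linarith)]
      ring
    have hcov : covol ((1 : ℝ), (0 : ℝ)) (-(1 / 2), s / 2) = s / 2 := by
      simp only [covol]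
      rw [abs_of_pos (by simpa using hspos)]
      ring
    refine wrap p hp I (1, 0) (-(1 / 2), s / 2) ?_ ?_ ?_ ?_ ?_
    · rw [hcov]; positivity
    · simp [hp0]
    · simpa only [abs_neg] using hhalf
    · convert hhalf using 4 <;> simp <;> norm_num
    · rw [hcov, hI]; ring
  · push Not at hcase
    have hI := hI₁ ⟨hcase.1.le, hcase.2.le⟩
    obtain ⟨ht0, ht1, hte⟩ := hτ p hp.le
    set t := τ p with ht
    have h1t : 0 < 1 - t := by linarith
    set c := (2 : ℝ) ^ (-(1 / p)) with hc
    have hcpos : 0 < c := Real.rpow_pos_of_pos (by norm_num) _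
    have hcp : c ^ p = 1 / 2 := by
      rw [hc, ← Real.rpow_mul (by norm_num), neg_mul, one_div_mul_cancel hp0, Real.rpow_neg_one]
      norm_num
    have hcc : (4 : ℝ) ^ (-(1 / p)) = c * c := by
      rw [hc, ← Real.mul_rpow (by norm_num) (by norm_num)]
      norm_num
    have hpt : 0 < (1 - t) ^ p := Real.rpow_pos_of_pos h1t _
    have hmain : (c / (1 - t)) ^ p + (c * t / (1 - t)) ^ p = 1 := by
      rw [Real.div_rpow hcpos.le h1t.le, Real.div_rpow (by positivity) h1t.le,
        Real.mul_rpow hcpos.le ht0, hcp, ← add_div, div_eq_one_iff_eq hpt.ne']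
      linarith
    have hcov : covol (c / (1 - t), -(c * t / (1 - t))) (-(c * t / (1 - t)), c / (1 - t))
        = c * c * (1 + t) / (1 - t) := by
      simp only [covol]
      have : c / (1 - t) * (c / (1 - t)) - -(c * t / (1 - t)) * -(c * t / (1 - t))
          = c * c * (1 + t) / (1 - t) := by
        field_simp
        ring
      rw [this, abs_of_pos (by positivity)]
    have hA : |c / (1 - t)| = c / (1 - t) := abs_of_pos (by positivity)
    have hB : |c * t / (1 - t)| = c * t / (1 - t) := abs_of_nonneg (by positivity)
    refine wrap p hp I (c / (1 - t), -(c * t / (1 - t))) (-(c * t / (1 - t)), c / (1 - t))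
      ?_ ?_ ?_ ?_ ?_
    · rw [hcov]; positivity
    · simp only [abs_neg, hA, hB]; exact hmain
    · simp only [abs_neg, hA, hB]; rw [add_comm]; exact hmain
    · have h1 : c / (1 - t) + -(c * t / (1 - t)) = c := by field_simp; ring
      have h2 : -(c * t / (1 - t)) + c / (1 - t) = c := by rw [add_comm]; exact h1
      simp only [Prod.fst_add, Prod.snd_add, h1, h2, abs_of_pos hcpos, hcp]
      norm_num
    · rw [hcov, hI, hcc]; ring

end
end

section
/- Let p > 1 be real. The translative kissing number of the Minkowski ball D_p equals 6; that is: (i) there exist six vectors w₁, …, w₆ ∈ ℝ² (for instance w = ±2(1,0), ±2(1/2, σ_p/2), ±2(−1/2, σ_p/2) with σ_p = (2ᵖ−1)^{1/p}) such that the translates D_p + wᵢ are pairwise disjoint, each disjoint from D_p, and the closure of each D_p + wᵢ meets the closure of D_p; and (ii) any family of translates of D_p that are pairwise disjoint, disjoint from D_p, and whose closures all meet the closure of D_p, has at most 6 members. -/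
namespace Kiss

/-- Points of two unit vectors in a common half-open cone of a regular hexagon are at distance
less than one. -/
lemma cone_lt (N : ℝ × ℝ → ℝ) (hs : ∀ (t : ℝ) z, N (t • z) = |t| * N z)
    (ht : ∀ x y, N (x + y) ≤ N x + N y)
    (hstrict : ∀ (x d : ℝ × ℝ) (g : ℝ), 0 < g → N x = 1 → N (x - d) = 1 → N d = 1 →
      N (x + g • d) ≠ 1)
    (a b : ℝ × ℝ) (ha : N a = 1) (hb : N b = 1) (hab : N (a - b) = 1)
    (α β γ δ : ℝ) (hα : 0 < α) (hβ : 0 ≤ β) (hγ : 0 < γ) (hδ : 0 ≤ δ)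
    (hx : N (α • a + β • b) = 1) (hy : N (γ • a + δ • b) = 1) :
    N ((α • a + β • b) - (γ • a + δ • b)) < 1 := by
  have hba : N (b - a) = 1 := by
    have := hs (-1) (a - b)
    rw [hab] at this
    rw [show b - a = (-1 : ℝ) • (a - b) by module, this]; norm_num
  have comb : ∀ (s t : ℝ) (x y : ℝ × ℝ), 0 ≤ s → 0 ≤ t → N x = 1 → N y = 1 →
      N (s • x + t • y) ≤ s + t := by
    intro s t x y h1 h2 h3 h4
    have := ht (s • x) (t • y)
    rw [hs, hs, h3, h4, abs_of_nonneg h1, abs_of_nonneg h2] at this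
    linarith
  have upper : ∀ (c d : ℝ × ℝ), N c = 1 → N d = 1 → N (c - d) = 1 → ∀ s t : ℝ, 0 ≤ s → 0 ≤ t →
      N (s • c + t • d) = 1 → s ≤ 1 := by
    intro c d hc hd hcd s t h1 h2 h
    by_contra hlt
    push Not at hlt
    have h3 := comb t 1 (c - d) (s • c + t • d) h2 zero_le_one hcd h
    have h4 : t • (c - d) + (1 : ℝ) • (s • c + t • d) = (s + t) • c := by module
    rw [h4, hs, hc, abs_of_nonneg (by linarith)] at h3
    linarith
  have α1 := upper a b ha hb hab α β hα.le hβ hx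
  have γ1 := upper a b ha hb hab γ δ hγ.le hδ hy
  have β1 := upper b a hb ha hba β α hβ hα.le (by rw [add_comm]; exact hx)
  have δ1 := upper b a hb ha hba δ γ hδ hγ.le (by rw [add_comm]; exact hy)
  have sx := comb α β a b hα.le hβ ha hb
  have sy := comb γ δ a b hγ.le hδ ha hb
  rw [hx] at sx
  rw [hy] at sy
  have key : ∀ g : ℝ, 0 < g → N (g • a + b) ≠ 1 := by
    intro g hg
    rw [add_comm]
    exact hstrict b a g hg hb hba ha
  have eqx : (α • a + β • b) - (γ • a + δ • b) = (α - γ) • a + (β - δ) • b := by module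
  have nβ : β ≠ 1 := by
    rintro rfl
    rw [one_smul] at hx
    exact key α hα hx
  have nδ : δ ≠ 1 := by
    rintro rfl
    rw [one_smul] at hy
    exact key γ hγ hy
  have β2 := lt_of_le_of_ne β1 nβ
  have δ2 := lt_of_le_of_ne δ1 nδ
  rw [eqx]
  have neg : ∀ z, N (-z) = N z := by
    intro z
    have := hs (-1) z
    simpa using this
  have anti : ∀ s t : ℝ, 0 ≤ s → 0 ≤ t → s < 1 → t < 1 → N (s • a - t • b) < 1 := by
    intro s t h1 h2 h3 h4
    rcases le_total t s with h | h
    · have := comb t (s - t) (a - b) a h2 (by linarith) hab ha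
      rw [show t • (a - b) + (s - t) • a = s • a - t • b by module] at this
      linarith
    · have := comb s (t - s) (b - a) b h1 (by linarith) hba hb
      rw [← neg, show -(s • a - t • b) = s • (b - a) + (t - s) • b by module]
      linarith
  rcases le_total γ α with h1 | h1 <;> rcases le_total δ β with h2 | h2
  · have := comb (α - γ) (β - δ) a b (by linarith) (by linarith) ha hb
    linarith
  · have := anti (α - γ) (δ - β) (by linarith) (by linarith) (by linarith) (by linarith)
    rw [show (α - γ) • a + (β - δ) • b = (α - γ) • a - (δ - β) • b by module]
    exact this
  · have := anti (γ - α) (β - δ) (by linarith) (by linarith) (by linarith) (by linarith)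
    rw [← neg, show -((α - γ) • a + (β - δ) • b) = (γ - α) • a - (β - δ) • b by module]
    exact this
  · have := comb (γ - α) (δ - β) a b (by linarith) (by linarith) ha hb
    rw [← neg, show -((α - γ) • a + (β - δ) • b) = (γ - α) • a + (δ - β) • b by module]
    linarith

/-- In coordinates, every nonzero vector is in one of six half-open cones. -/
def inCone (i : Fin 6) (α β : ℝ) : Prop :=
  match i with
  | 0 => 0 < α ∧ 0 ≤ β
  | 1 => 0 < α + β ∧ 0 ≤ -α
  | 2 => 0 < β ∧ 0 ≤ -α - β
  | 3 => 0 < -α ∧ 0 ≤ -β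
  | 4 => 0 < -α - β ∧ 0 ≤ α
  | 5 => 0 < -β ∧ 0 ≤ α + β

lemma exists_inCone (α β : ℝ) (h : α ≠ 0 ∨ β ≠ 0) : ∃ i, inCone i α β := by
  by_contra hc
  push Not at hc
  have h0 := hc 0
  have h1 := hc 1
  have h2 := hc 2
  have h3 := hc 3
  have h4 := hc 4
  have h5 := hc 5
  simp only [inCone, not_and, not_le] at h0 h1 h2 h3 h4 h5
  rcases lt_trichotomy β 0 with hβ | hβ | hβ
  · rcases lt_or_ge α 0 with hα | hα
    · linarith [h3 (by linarith)]
    · rcases lt_or_ge (α + β) 0 with hs | hs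
      · linarith [h4 (by linarith)]
      · linarith [h5 (by linarith)]
  · subst hβ
    rcases lt_trichotomy α 0 with hα | hα | hα
    · linarith [h3 (by linarith)]
    · simp [hα] at h
    · linarith [h0 (by linarith)]
  · rcases lt_or_ge 0 α with hα | hα
    · linarith [h0 (by linarith)]
    · rcases lt_or_ge 0 (α + β) with hs | hs
      · linarith [h1 (by linarith)]
      · linarith [h2 (by linarith)]

lemma upper_bound (N : ℝ × ℝ → ℝ) (hs : ∀ (t : ℝ) z, N (t • z) = |t| * N z)
    (ht : ∀ x y, N (x + y) ≤ N x + N y)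
    (hstrict : ∀ (x d : ℝ × ℝ) (g : ℝ), 0 < g → N x = 1 → N (x - d) = 1 → N d = 1 →
      N (x + g • d) ≠ 1)
    (a b : ℝ × ℝ) (ha : N a = 1) (hb : N b = 1) (hab : N (a - b) = 1)
    (hspan : ∀ z : ℝ × ℝ, ∃ α β : ℝ, z = α • a + β • b)
    (k : ℕ) (u : Fin k → ℝ × ℝ) (hu : ∀ i, N (u i) = 1)
    (hd : ∀ i j, i ≠ j → 1 ≤ N (u i - u j)) : k ≤ 6 := by
  have neg : ∀ z, N (-z) = N z := by
    intro z
    have := hs (-1) z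
    simpa using this
  have hba : N (b - a) = 1 := by rw [← neg, neg_sub, hab]
  choose A B hAB using fun i => hspan (u i)
  have hne : ∀ i, A i ≠ 0 ∨ B i ≠ 0 := by
    intro i
    by_contra h
    push Not at h
    have h1 := hu i
    rw [hAB i, h.1, h.2] at h1
    have h2 := hs 0 0
    simp at h2
    simp [h2] at h1
  choose c hc using fun i => exists_inCone (A i) (B i) (hne i)
  by_contra hk
  push Not at hk
  obtain ⟨i, j, hij, hcij⟩ := Fintype.exists_ne_map_eq_of_card_lt c (by simpa using hk)
  have hi := hc i
  have hj := hc j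
  rw [← hcij] at hj
  refine absurd (hd i j hij) (not_le.mpr ?_)
  have go : ∀ (x y : ℝ × ℝ), N x = 1 → N y = 1 → N (x - y) = 1 → ∀ α β γ δ : ℝ,
      0 < α ∧ 0 ≤ β → 0 < γ ∧ 0 ≤ δ → u i = α • x + β • y → u j = γ • x + δ • y →
      N (u i - u j) < 1 := by
    intro x y hx hy hxy α β γ δ h1 h2 e1 e2
    have n1 := hu i
    have n2 := hu j
    rw [e1] at n1
    rw [e2] at n2
    rw [e1, e2]
    exact cone_lt N hs ht hstrict x y hx hy hxy α β γ δ h1.1 h1.2 h2.1 h2.2 n1 n2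
  generalize c i = ci at hi hj
  have ei := hAB i
  have ej := hAB j
  fin_cases ci
  · exact go a b ha hb hab _ _ _ _ hi hj ei ej
  · exact go b (b - a) hb hba (by rw [sub_sub_cancel, ha]) _ _ _ _ hi hj
      (by rw [ei]; module) (by rw [ej]; module)
  · exact go (b - a) (-a) hba (by rw [neg, ha]) (by rw [sub_neg_eq_add, sub_add_cancel, hb])
      _ _ _ _ hi hj (by rw [ei]; module) (by rw [ej]; module)
  · exact go (-a) (-b) (by rw [neg, ha]) (by rw [neg, hb])
      (by rw [show -a - -b = b - a by module, hba])
      _ _ _ _ hi hj (by rw [ei]; module) (by rw [ej]; module)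
  · exact go (-b) (a - b) (by rw [neg, hb]) hab
      (by rw [show -b - (a - b) = -a by module, neg, ha])
      _ _ _ _ hi hj (by rw [ei]; module) (by rw [ej]; module)
  · exact go (a - b) a hab ha
      (by rw [show a - b - a = -b by module, neg, hb])
      _ _ _ _ hi hj (by rw [ei]; module) (by rw [ej]; module)

lemma lower_bound (N : ℝ × ℝ → ℝ) (hs : ∀ (t : ℝ) z, N (t • z) = |t| * N z)
    (ht : ∀ x y, N (x + y) ≤ N x + N y)
    (a b : ℝ × ℝ) (ha : N a = 1) (hb : N b = 1) (hab : N (a - b) = 1) :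
    ∃ w : Fin 6 → ℝ × ℝ, (∀ i, N (w i) = 2) ∧ ∀ i j, i ≠ j → 2 ≤ N (w i - w j) := by
  have neg : ∀ z, N (-z) = N z := by
    intro z
    have := hs (-1) z
    simpa using this
  have hba : N (b - a) = 1 := by rw [← neg, neg_sub, hab]
  have dbl : ∀ x, N x = 1 → N ((2 : ℝ) • x) = 2 := by
    intro x hx
    rw [hs, hx]; norm_num
  have sum : ∀ x y, N x = 1 → N y = 1 → N (x - y) = 1 → 1 ≤ N (x + y) := by
    intro x y hx hy hxy
    have := ht (x + y) (x - y)
    rw [show x + y + (x - y) = (2 : ℝ) • x by module, dbl x hx, hxy] at this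
    linarith
  let v : Fin 6 → ℝ × ℝ := ![a, b, b - a, -a, -b, a - b]
  have hv : ∀ i, N (v i) = 1 := by
    intro i
    fin_cases i <;> simp [v, neg, ha, hb, hab, hba]
  have h2 : ∀ x, N x = 1 → 1 ≤ N ((2 : ℝ) • x) := fun x hx => by rw [dbl x hx]; norm_num
  have s1 := sum a b ha hb hab
  have s2 := sum b (b - a) hb hba (by rw [sub_sub_cancel, ha])
  have s3 := sum a (a - b) ha hab (by rw [sub_sub_cancel, hb])
  have hd : ∀ i j, i < j → 1 ≤ N (v i - v j) := by
    have t1 : N (a - (b - a)) = N (a + (a - b)) := by congr 1; module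
    have t2 : N (a - -a) = N ((2 : ℝ) • a) := by congr 1; module
    have t3 : N (a - -b) = N (a + b) := by congr 1; module
    have t4 : N (a - (a - b)) = N b := by congr 1; module
    have t5 : N (b - (b - a)) = N a := by congr 1; module
    have t6 : N (b - -a) = N (a + b) := by congr 1; module
    have t7 : N (b - -b) = N ((2 : ℝ) • b) := by congr 1; module
    have t8 : N (b - (a - b)) = N (b + (b - a)) := by congr 1; module
    have t9 : N (b - a - -a) = N b := by congr 1; module
    have t10 : N (b - a - -b) = N (b + (b - a)) := by congr 1; module
    have t11 : N (b - a - (a - b)) = N ((2 : ℝ) • (b - a)) := by congr 1; module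
    have t12 : N (-a - -b) = N (b - a) := by congr 1; module
    have t13 : N (-a - (a - b)) = N (a + (a - b)) := by rw [← neg]; congr 1; module
    have t14 : N (-b - (a - b)) = N a := by rw [← neg]; congr 1; module
    have d1 := h2 a ha
    have d2 := h2 b hb
    have d3 := h2 (b - a) hba
    intro i j hij
    fin_cases i <;> fin_cases j <;>
      first
      | exact absurd hij (by decide)
      | (show 1 ≤ N (_ - _)
         dsimp [v]
         linarith)
  refine ⟨fun i => (2 : ℝ) • v i, fun i => dbl _ (hv i), ?_⟩
  intro i j hij
  have h3 : 1 ≤ N (v i - v j) := by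
    rcases lt_or_gt_of_ne hij with h | h
    · exact hd i j h
    · rw [← neg, neg_sub]; exact hd j i h
  simp only
  rw [← smul_sub, hs]
  norm_num
  linarith

/-- The translation-body part. -/
lemma main (N : ℝ × ℝ → ℝ) (hs : ∀ (t : ℝ) z, N (t • z) = |t| * N z)
    (ht : ∀ x y, N (x + y) ≤ N x + N y) (hcont : Continuous N)
    (hstrict : ∀ (x d : ℝ × ℝ) (g : ℝ), 0 < g → N x = 1 → N (x - d) = 1 → N d = 1 →
      N (x + g • d) ≠ 1)
    (a b : ℝ × ℝ) (ha : N a = 1) (hb : N b = 1) (hab : N (a - b) = 1)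
    (hspan : ∀ z : ℝ × ℝ, ∃ α β : ℝ, z = α • a + β • b)
    (D : Set (ℝ × ℝ)) (hD : D = {z | N z < 1}) :
    (∃ w : Fin 6 → ℝ × ℝ, Function.Injective w ∧
        (Pairwise fun i j => Disjoint ((fun x => x + w i) '' D) ((fun x => x + w j) '' D)) ∧
        (∀ i, Disjoint ((fun x => x + w i) '' D) D) ∧
        (∀ i, (closure ((fun x => x + w i) '' D) ∩ closure D).Nonempty))
    ∧ (∀ (k : ℕ) (w : Fin k → ℝ × ℝ), Function.Injective w →
        (Pairwise fun i j => Disjoint ((fun x => x + w i) '' D) ((fun x => x + w j) '' D)) →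
        (∀ i, Disjoint ((fun x => x + w i) '' D) D) →
        (∀ i, (closure ((fun x => x + w i) '' D) ∩ closure D).Nonempty) →
        k ≤ 6) := by
  have neg : ∀ z, N (-z) = N z := by
    intro z
    have := hs (-1) z
    simpa using this
  have hN0 : N 0 = 0 := by
    have := hs 0 0
    simpa using this
  have hmem : ∀ z, z ∈ D ↔ N z < 1 := by intro z; rw [hD]; rfl
  have hdis : ∀ x y : ℝ × ℝ, Disjoint ((fun z => z + x) '' D) ((fun z => z + y) '' D) ↔
      2 ≤ N (x - y) := by
    intro x y
    constructor
    · intro h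
      by_contra hlt
      push Not at hlt
      have hh : N ((1 / 2 : ℝ) • (x - y)) < 1 := by
        rw [hs, abs_of_pos (by norm_num)]; linarith
      have h' := Set.disjoint_left.mp h
      refine @h' ((1 / 2 : ℝ) • (x + y)) ?_ ?_
      · refine ⟨-((1 / 2 : ℝ) • (x - y)), ?_, by simp only; module⟩
        rw [hmem, neg]; exact hh
      · refine ⟨((1 / 2 : ℝ) • (x - y)), ?_, by simp only; module⟩
        rw [hmem]; exact hh
    · intro h
      rw [Set.disjoint_left]
      rintro z ⟨u, hu, rfl⟩ ⟨v, hv, hvu⟩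
      rw [hmem] at hu hv
      simp only at hvu
      have e : x - y = v + -u := by
        have : v = u + x - y := eq_sub_of_add_eq hvu
        rw [this]; abel
      have := ht v (-u)
      rw [← e, neg] at this
      linarith
  have hdis0 : ∀ x : ℝ × ℝ, Disjoint ((fun z => z + x) '' D) D ↔ 2 ≤ N x := by
    intro x
    have := hdis x 0
    simpa using this
  have hcl : closure D = {z | N z ≤ 1} := by
    apply Set.Subset.antisymm
    · apply closure_minimal
      · intro z hz
        exact ((hmem z).1 hz).le
      · exact isClosed_le hcont continuous_const
    · intro z hz
      have hz' : N z ≤ 1 := hz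
      have h1 : (1 : ℝ) ∈ closure (Set.Ico (0 : ℝ) 1) := by
        rw [closure_Ico (by norm_num)]; simp
      have h2 : Continuous fun t : ℝ => t • z := by fun_prop
      have h3 := map_mem_closure h2 h1 (t := D) (by
        intro t ht'
        rw [hmem, hs, abs_of_nonneg ht'.1]
        have h5 := ht'.2
        have h6 := ht'.1
        nlinarith)
      simpa using h3
  have hcl2 : ∀ x : ℝ × ℝ, closure ((fun z => z + x) '' D) = (fun z => z + x) '' closure D := by
    intro x
    exact ((Homeomorph.addRight x).image_closure D).symm
  have htouch : ∀ x : ℝ × ℝ, (closure ((fun z => z + x) '' D) ∩ closure D).Nonempty ↔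
      N x ≤ 2 := by
    intro x
    rw [hcl2, hcl]
    constructor
    · rintro ⟨z, ⟨u, hu, rfl⟩, hz⟩
      have h1 : N u ≤ 1 := hu
      have h2 : N (u + x) ≤ 1 := hz
      have := ht (u + x) (-u)
      rw [neg, show u + x + -u = x by abel] at this
      linarith
    · intro h
      have hh : N ((1 / 2 : ℝ) • x) ≤ 1 := by
        rw [hs, abs_of_pos (by norm_num)]; linarith
      refine ⟨(1 / 2 : ℝ) • x, ⟨-((1 / 2 : ℝ) • x), ?_, by simp only; module⟩, hh⟩
      show N _ ≤ 1
      rw [neg]; exact hh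
  constructor
  · obtain ⟨w, hw, hd⟩ := lower_bound N hs ht a b ha hb hab
    refine ⟨w, ?_, ?_, ?_, ?_⟩
    · intro i j hij
      by_contra hne
      have := hd i j hne
      rw [hij, sub_self, hN0] at this
      linarith
    · intro i j hij
      exact (hdis _ _).2 (hd i j hij)
    · intro i
      exact (hdis0 _).2 (hw i).ge
    · intro i
      exact (htouch _).2 (hw i).le
  · intro k w _ h1 h2 h3
    apply upper_bound N hs ht hstrict a b ha hb hab hspan k (fun i => (1 / 2 : ℝ) • w i)
    · intro i
      have e := le_antisymm ((htouch _).1 (h3 i)) ((hdis0 _).1 (h2 i))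
      rw [hs, e, abs_of_pos (by norm_num)]; norm_num
    · intro i j hij
      have := (hdis _ _).1 (h1 hij)
      rw [← smul_sub, hs, abs_of_pos (by norm_num)]
      linarith

lemma abs_rpow_conv (p : ℝ) (hp : 1 < p) (x y s t : ℝ) (hs : 0 < s) (ht : 0 < t)
    (hst : s + t = 1) : |s * x + t * y| ^ p ≤ s * |x| ^ p + t * |y| ^ p := by
  have h1 : |s * x + t * y| ≤ s * |x| + t * |y| := by
    have := abs_add_le (s * x) (t * y)
    rwa [abs_mul, abs_mul, abs_of_pos hs, abs_of_pos ht] at this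
  have h2 := (convexOn_rpow hp.le).2 (abs_nonneg x) (abs_nonneg y) hs.le ht.le hst
  simp only [smul_eq_mul] at h2
  exact (Real.rpow_le_rpow (abs_nonneg _) h1 (by linarith)).trans h2

lemma abs_rpow_strict (p : ℝ) (hp : 1 < p) (x y s t : ℝ) (hs : 0 < s) (ht : 0 < t)
    (hst : s + t = 1) (hxy : x ≠ y) : |s * x + t * y| ^ p < s * |x| ^ p + t * |y| ^ p := by
  have h1 : |s * x + t * y| ≤ s * |x| + t * |y| := by
    have := abs_add_le (s * x) (t * y)
    rwa [abs_mul, abs_mul, abs_of_pos hs, abs_of_pos ht] at this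
  by_cases h : |x| = |y|
  · have hy : y = -x := by
      rcases abs_eq_abs.1 h with h | h
      · exact absurd h hxy
      · linarith
    have hx0 : 0 < |x| := by
      rw [abs_pos]; rintro rfl; simp at hy; exact hxy hy.symm
    have h3 : |s * x + t * y| < |x| := by
      rw [hy, show s * x + t * -x = (s - t) * x by ring, abs_mul]
      have : |s - t| < 1 := by rw [abs_lt]; constructor <;> linarith
      nlinarith
    have h4 := Real.rpow_lt_rpow (abs_nonneg _) h3 (by linarith : 0 < p)
    rw [← h, ← add_mul, hst, one_mul]
    exact h4
  · have h2 := (strictConvexOn_rpow hp).2 (abs_nonneg x) (abs_nonneg y) h hs ht hst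
    simp only [smul_eq_mul] at h2
    exact (Real.rpow_le_rpow (abs_nonneg _) h1 (by linarith)).trans_lt h2

end Kiss

/-- For real `p > 1`, the translative kissing number of the
Minkowski ball `D_p` equals `6`: (i) there are six translates of `D_p` that are
pairwise disjoint, disjoint from `D_p`, and whose closures meet the closure of
`D_p`; (ii) any such family has at most `6` members. -/
theorem statement_14 (p : ℝ) (hp : 1 < p)
    (D : Set (ℝ × ℝ)) (hD : D = {z : ℝ × ℝ | |z.1| ^ p + |z.2| ^ p < 1}) :
    (∃ w : Fin 6 → ℝ × ℝ, Function.Injective w ∧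
        (Pairwise fun i j => Disjoint ((fun x => x + w i) '' D) ((fun x => x + w j) '' D)) ∧
        (∀ i, Disjoint ((fun x => x + w i) '' D) D) ∧
        (∀ i, (closure ((fun x => x + w i) '' D) ∩ closure D).Nonempty))
    ∧ (∀ (k : ℕ) (w : Fin k → ℝ × ℝ), Function.Injective w →
        (Pairwise fun i j => Disjoint ((fun x => x + w i) '' D) ((fun x => x + w j) '' D)) →
        (∀ i, Disjoint ((fun x => x + w i) '' D) D) →
        (∀ i, (closure ((fun x => x + w i) '' D) ∩ closure D).Nonempty) →
        k ≤ 6) := by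
  have hp0 : 0 < p := by linarith
  let f : ℝ × ℝ → ℝ := fun z => |z.1| ^ p + |z.2| ^ p
  have hf0 : ∀ z, 0 ≤ f z := fun z => by positivity
  let N : ℝ × ℝ → ℝ := fun z => f z ^ (1 / p)
  have hs : ∀ (t : ℝ) z, N (t • z) = |t| * N z := by
    intro t z
    have h1 : f (t • z) = |t| ^ p * f z := by
      simp only [f, Prod.smul_fst, Prod.smul_snd, smul_eq_mul, abs_mul]
      rw [Real.mul_rpow (abs_nonneg _) (abs_nonneg _), Real.mul_rpow (abs_nonneg _) (abs_nonneg _)]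
      ring
    show f (t • z) ^ (1 / p) = |t| * f z ^ (1 / p)
    rw [h1, Real.mul_rpow (by positivity) (hf0 z), one_div, Real.rpow_rpow_inv (abs_nonneg _) hp0.ne']
  have ht : ∀ x y, N (x + y) ≤ N x + N y := by
    intro x y
    have := Real.Lp_add_le (Finset.univ : Finset (Fin 2)) ![x.1, x.2] ![y.1, y.2] hp.le
    simpa [Fin.sum_univ_two, N, f] using this
  have hcont : Continuous N := by
    have hf : Continuous f := by
      refine Continuous.add ?_ ?_
      · exact (continuous_fst.abs).rpow_const fun _ => Or.inr hp0.le
      · exact (continuous_snd.abs).rpow_const fun _ => Or.inr hp0.le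
    exact hf.rpow_const fun _ => Or.inr (by positivity)
  have hN1 : ∀ z, N z = 1 ↔ f z = 1 := by
    intro z
    constructor
    · intro h
      have h2 : (f z ^ p⁻¹) ^ p = f z := Real.rpow_inv_rpow (hf0 z) hp0.ne'
      rw [← h2, ← one_div, show f z ^ (1 / p) = 1 from h, Real.one_rpow]
    · intro h
      show f z ^ (1 / p) = 1
      rw [h, Real.one_rpow]
  have hstrict : ∀ (x d : ℝ × ℝ) (g : ℝ), 0 < g → N x = 1 → N (x - d) = 1 → N d = 1 →
      N (x + g • d) ≠ 1 := by
    intro x d g hg h1 h2 h3 h4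
    rw [hN1] at h1 h2 h3 h4
    have hg1 : 0 < g + 1 := by linarith
    have hsum : g / (g + 1) + 1 / (g + 1) = 1 := by field_simp
    have e1 : x.1 = g / (g + 1) * (x - d).1 + 1 / (g + 1) * (x + g • d).1 := by
      simp only [Prod.fst_sub, Prod.fst_add, Prod.smul_fst, smul_eq_mul]; field_simp; ring
    have e2 : x.2 = g / (g + 1) * (x - d).2 + 1 / (g + 1) * (x + g • d).2 := by
      simp only [Prod.snd_sub, Prod.snd_add, Prod.smul_snd, smul_eq_mul]; field_simp; ring
    have hS : 0 < g / (g + 1) := by positivity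
    have hT : 0 < 1 / (g + 1) := by positivity
    have c1 := Kiss.abs_rpow_conv p hp (x - d).1 (x + g • d).1 _ _ hS hT hsum
    have c2 := Kiss.abs_rpow_conv p hp (x - d).2 (x + g • d).2 _ _ hS hT hsum
    have s1 := Kiss.abs_rpow_strict p hp (x - d).1 (x + g • d).1 _ _ hS hT hsum
    have s2 := Kiss.abs_rpow_strict p hp (x - d).2 (x + g • d).2 _ _ hS hT hsum
    rw [← e1] at c1 s1
    rw [← e2] at c2 s2
    simp only [f] at h1 h2 h4
    have tot : g / (g + 1) * (|(x - d).1| ^ p + |(x - d).2| ^ p) +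
        1 / (g + 1) * (|(x + g • d).1| ^ p + |(x + g • d).2| ^ p) = 1 := by
      rw [h2, h4, mul_one, mul_one, hsum]
    have hd : d.1 ≠ 0 ∨ d.2 ≠ 0 := by
      by_contra hc
      push Not at hc
      simp [f, hc.1, hc.2, Real.zero_rpow hp0.ne'] at h3
    rcases hd with hd | hd
    · have : (x - d).1 ≠ (x + g • d).1 := by
        simp only [Prod.fst_sub, Prod.fst_add, Prod.smul_fst, smul_eq_mul]
        intro h
        have : (g + 1) * d.1 = 0 := by linarith
        rcases mul_eq_zero.1 this with h | h
        · linarith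
        · exact hd h
      have := s1 this
      linarith
    · have : (x - d).2 ≠ (x + g • d).2 := by
        simp only [Prod.snd_sub, Prod.snd_add, Prod.smul_snd, smul_eq_mul]
        intro h
        have : (g + 1) * d.2 = 0 := by linarith
        rcases mul_eq_zero.1 this with h | h
        · linarith
        · exact hd h
      have := s2 this
      linarith
  obtain ⟨r, hr, hrp⟩ : ∃ r : ℝ, 0 < r ∧ (1 / 2 : ℝ) ^ p + r ^ p = 1 := by
    have h : (1 / 2 : ℝ) ^ p < 1 := Real.rpow_lt_one (by norm_num) (by norm_num) hp0
    refine ⟨(1 - (1 / 2 : ℝ) ^ p) ^ p⁻¹, Real.rpow_pos_of_pos (by linarith) _, ?_⟩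
    rw [Real.rpow_inv_rpow (by linarith) hp0.ne']
    ring
  refine Kiss.main N hs ht hcont hstrict (1, 0) (1 / 2, r) ?_ ?_ ?_ ?_ D ?_
  · rw [hN1]
    simp [f, Real.zero_rpow hp0.ne']
  · rw [hN1]
    simp only [f]
    rw [abs_of_pos hr, abs_of_pos (by norm_num : (0 : ℝ) < 1 / 2)]
    exact hrp
  · rw [hN1]
    simp only [f, Prod.fst_sub, Prod.snd_sub]
    rw [show (1 : ℝ) - 1 / 2 = 1 / 2 by norm_num, zero_sub, abs_neg, abs_of_pos hr,
      abs_of_pos (by norm_num : (0 : ℝ) < 1 / 2)]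
    exact hrp
  · intro z
    refine ⟨z.1 - z.2 / r / 2, z.2 / r, ?_⟩
    ext
    · simp; ring
    · simp; field_simp
  · rw [hD]
    ext z
    show f z < 1 ↔ f z ^ (1 / p) < 1
    rw [Real.rpow_lt_one_iff' (hf0 z) (by positivity)]
end
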